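/- Let n > 2 with n ≡ 1 (mod 3) and let t ≥ 2. Let G be the graph of t 2n-gons in a line: a chain of t cycles of length 2n in which consecutive cycles share exactly one edge, the two shared edges of each interior cycle being antipodal. Then the matching complex M(G) is homotopy equivalent to a wedge of exactly t spheres, each of dimension (2nt + t)/3 − t. -/

import Mathlib

open SimpleGraph

/-- Two edges (as elements of `Sym2 V`) are incident if they share a vertex. -/
def EdgeIncident {V : Type*} (e f : Sym2 V) : Prop := ∃ v, v ∈ e ∧ v ∈ f

/-- The matching complex of a graph, as the set of its faces:
finite sets of pairwise non-incident edges of `G`. -/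
def matchingComplex {V : Type*} (G : SimpleGraph V) : Set (Finset (Sym2 V)) :=
  {m | (∀ e ∈ m, e ∈ G.edgeSet) ∧
    (m : Set (Sym2 V)).Pairwise fun e f => ¬ EdgeIncident e f}

/-- The geometric realization of an abstract simplicial complex, given as a
downward-closed set of finite subsets of the vertex type `α`. -/
abbrev Realization {α : Type*} (K : Set (Finset α)) : Type _ :=
  { f : α → ℝ // (∀ a, 0 ≤ f a) ∧
      ∃ s ∈ K, (∀ a, f a ≠ 0 → a ∈ s) ∧ ∑ a ∈ s, f a = 1 }

/-- The `n`-dimensional sphere. -/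
abbrev SphereD (n : ℕ) : Type :=
  Metric.sphere (0 : EuclideanSpace ℝ (Fin (n + 1))) 1

/-- A basepoint of the `n`-sphere. -/
noncomputable def SphereD.pt (n : ℕ) : SphereD n :=
  ⟨EuclideanSpace.single 0 1, by simp [EuclideanSpace.norm_single]⟩

/-- The relation collapsing all basepoints (and the extra point) of a
family of pointed spaces to one point. -/
def WedgeRel {ι : Type*} (X : ι → Type*) (pt : ∀ i, X i) :
    ((Σ i, X i) ⊕ Unit) → ((Σ i, X i) ⊕ Unit) → Prop := fun p q =>
  (p = Sum.inr () ∨ ∃ i, p = Sum.inl ⟨i, pt i⟩) ∧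
  (q = Sum.inr () ∨ ∃ i, q = Sum.inl ⟨i, pt i⟩)

/-- The wedge sum of a family of pointed spaces (with an extra basepoint, so that
the wedge of the empty family is a one-point space). -/
abbrev PWedge {ι : Type*} (X : ι → Type*) [∀ i, TopologicalSpace (X i)]
    (pt : ∀ i, X i) : Type _ :=
  Quot (WedgeRel X pt)

/-- A wedge of spheres with prescribed dimensions `d i`. -/
noncomputable abbrev WedgeOfSpheres {ι : Type*} (d : ι → ℕ) : Type _ :=
  PWedge (fun i => SphereD (d i)) (fun i => SphereD.pt (d i))

/-- The graph of `t` `2n`-gons in a line, realized on vertices in `ℤ × ℤ`: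
two horizontal paths `(0,0),…,(t(n-1),0)` and `(0,1),…,(t(n-1),1)`, together with
the vertical (shared, antipodal) edges `(j(n-1),0)–(j(n-1),1)` for `j = 0,…,t`. -/
def polygonChain (n t : ℕ) : SimpleGraph (ℤ × ℤ) :=
  SimpleGraph.fromRel fun p q =>
    ((p.2 = 0 ∨ p.2 = 1) ∧ q.2 = p.2 ∧ q.1 = p.1 + 1 ∧
      0 ≤ p.1 ∧ p.1 < (t : ℤ) * ((n : ℤ) - 1)) ∨
    (p.2 = 0 ∧ q.2 = 1 ∧ q.1 = p.1 ∧ (((n : ℤ) - 1) ∣ p.1) ∧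
      0 ≤ p.1 ∧ p.1 ≤ (t : ℤ) * ((n : ℤ) - 1))

open Topology

/-- Collapsing a contractible closed subspace along which `X × [0, 1]` retracts is a homotopy
equivalence. -/
theorem homotopyEquiv_of_collapse {A X Y : Type*} [TopologicalSpace A] [TopologicalSpace X]
    [TopologicalSpace Y] [ContractibleSpace A] {j : A → X} (hj : IsClosedEmbedding j)
    (R : C(X × unitInterval, X × unitInterval)) (hR_zero : ∀ x, R (x, 0) = (x, 0))
    (hR_fix : ∀ a s, R (j a, s) = (j a, s))
    (hR_mem : ∀ z, (R z).2 = 0 ∨ (R z).1 ∈ Set.range j)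
    (q : C(X, Y)) (hq : IsQuotientMap q)
    (hfib : ∀ x y, q x = q y ↔ x = y ∨ (x ∈ Set.range j ∧ y ∈ Set.range j)) :
    Nonempty (ContinuousMap.HomotopyEquiv X Y) := by
  classical
  obtain ⟨p, ⟨H⟩⟩ := id_nullhomotopic A
  let φ : X × unitInterval → X := fun z =>
    if h : z.1 ∈ Set.range j then j (H (z.2, h.choose)) else z.1
  have φ_j : ∀ a s, φ (j a, s) = j (H (s, a)) := by
    intro a s
    have h : j a ∈ Set.range j := ⟨a, rfl⟩
    have : h.choose = a := hj.injective h.choose_spec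
    simp only [φ, dif_pos h, this]
  have φ_zero : ∀ x, φ (x, 0) = x := by
    intro x
    by_cases h : x ∈ Set.range j
    · obtain ⟨a, rfl⟩ := h
      simp [φ_j]
    · simp only [φ, dif_neg h]
  have hφ : ContinuousOn φ
      ({z : X × unitInterval | z.2 = 0} ∪ {z : X × unitInterval | z.1 ∈ Set.range j}) := by
    refine ContinuousOn.union_of_isClosed ?_ ?_ (isClosed_eq continuous_snd continuous_const)
      (hj.isClosed_range.preimage continuous_fst)
    · refine continuous_fst.continuousOn.congr ?_
      rintro ⟨x, s⟩ (rfl : s = 0)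
      exact φ_zero x
    · have hjI : IsClosedEmbedding (Prod.map j (id : unitInterval → unitInterval)) := hj.prodMap .id
      have hset : {z : X × unitInterval | z.1 ∈ Set.range j} =
          Set.range (Prod.map j (id : unitInterval → unitInterval)) := by
        ext ⟨x, s⟩
        simp
      rw [hset, ← Set.image_univ, hjI.isInducing.continuousOn_image_iff]
      refine Continuous.continuousOn ?_
      have : φ ∘ Prod.map j id = fun z : A × unitInterval => j (H (z.2, z.1)) := by
        ext ⟨a, s⟩
        exact φ_j a s
      rw [this]
      exact hj.continuous.comp (H.continuous.comp continuous_swap)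
  let G : C(X × unitInterval, X) := ⟨φ ∘ R, by
    rw [← continuousOn_univ]
    exact hφ.comp R.continuous.continuousOn fun z _ => hR_mem z⟩
  have G_zero : ∀ x, G (x, 0) = x := fun x => by simp [G, hR_zero, φ_zero]
  have G_j : ∀ a s, G (j a, s) = j (H (s, a)) := fun a s => by simp [G, hR_fix, φ_j]
  have G_one : ∀ a, G (j a, 1) = j p := fun a => by simp [G_j]
  let G₁ : C(X, X) := G.comp (.prodMk (.id X) (.const X 1))
  have hG₁ : Function.FactorsThrough G₁ q := by
    intro x y hxy
    rcases (hfib x y).1 hxy with rfl | ⟨⟨a, rfl⟩, ⟨b, rfl⟩⟩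
    · rfl
    · simp [G₁, G_one]
  let K : C(X, C(unitInterval, Y)) := (q.comp G).curry
  have hK : Function.FactorsThrough K q := by
    intro x y hxy
    rcases (hfib x y).1 hxy with rfl | ⟨⟨a, rfl⟩, ⟨b, rfl⟩⟩
    · rfl
    · ext s
      simp only [K, ContinuousMap.curry_apply, ContinuousMap.comp_apply, G_j]
      exact (hfib _ _).2 (Or.inr ⟨⟨_, rfl⟩, ⟨_, rfl⟩⟩)
  obtain ⟨g, hg⟩ : ∃ g : C(Y, X), ∀ x, g (q x) = G (x, 1) :=
    ⟨hq.lift G₁ hG₁, fun x => DFunLike.congr_fun (hq.lift_comp G₁ hG₁) x⟩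
  obtain ⟨k, hk⟩ : ∃ k : C(Y, C(unitInterval, Y)), ∀ x s, k (q x) s = q (G (x, s)) :=
    ⟨hq.lift K hK, fun x s => DFunLike.congr_fun (DFunLike.congr_fun (hq.lift_comp K hK) x) s⟩
  refine ⟨⟨q, g, ?_, ?_⟩⟩
  · refine ContinuousMap.Homotopic.symm
      ⟨⟨G.comp .prodSwap, fun x => ?_, fun x => ?_⟩⟩
    · simp [G_zero]
    · simp [hg]
  · refine ContinuousMap.Homotopic.symm
      ⟨⟨k.uncurry.comp .prodSwap, fun y => ?_, fun y => ?_⟩⟩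
    · obtain ⟨x, rfl⟩ := hq.surjective y
      simp [hk, G_zero]
    · obtain ⟨x, rfl⟩ := hq.surjective y
      simp [hk, hg]

namespace Realization

variable {α : Type*} {K L : Set (Finset α)}

theorem exists_support (hK : IsLowerSet K) (x : Realization K) :
    ∃ s ∈ K, (∀ a, x.1 a ≠ 0 ↔ a ∈ s) ∧ ∑ a ∈ s, x.1 a = 1 := by
  classical
  obtain ⟨s, hs, hsupp, hsum⟩ := x.2.2
  refine ⟨s.filter (fun a => x.1 a ≠ 0), hK (Finset.filter_subset _ s) hs, fun a => ?_, ?_⟩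
  · simpa using hsupp a
  · rw [Finset.sum_filter_ne_zero, hsum]

/-- The inclusion of realizations induced by an inclusion of complexes. -/
def incl (h : L ⊆ K) (x : Realization L) : Realization K :=
  ⟨x.1, x.2.1, x.2.2.imp fun _ hs => ⟨h hs.1, hs.2⟩⟩

theorem isEmbedding_incl (h : L ⊆ K) : IsEmbedding (incl h) :=
  .of_comp (by unfold incl; fun_prop) continuous_subtype_val .subtypeVal

end Realization

section Retraction

variable {α : Type*}

/-- The faces of `K` that contain no member of `F`. -/
def avoiding (K : Set (Finset α)) (F : Finset (Finset α)) : Set (Finset α) :=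
  {s | s ∈ K ∧ ∀ σ ∈ F, ¬ σ ⊆ s}

theorem avoiding_subset (K : Set (Finset α)) (F : Finset (Finset α)) : avoiding K F ⊆ K :=
  fun _ h => h.1

theorem IsLowerSet.avoiding {K : Set (Finset α)} (hK : IsLowerSet K) (F : Finset (Finset α)) :
    IsLowerSet (avoiding K F) :=
  fun _ _ h hs => ⟨hK h hs.1, fun σ hσ hσt => hs.2 σ hσ (hσt.trans h)⟩

open Classical in
/-- The amount that is subtracted at `a` when every simplex of `F` is shrunk by at most `c`. -/
noncomputable def shrinkage (F : Finset (Finset α)) (c : ℝ) (x : α → ℝ) (a : α) : ℝ :=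
  (F.filter (a ∈ ·)).fold max 0 fun σ => σ.fold min c x

/-- The distance to the subcomplex of faces that contain no member of `F`. -/
noncomputable def depth (F : Finset (Finset α)) (x : α → ℝ) : ℝ :=
  F.fold max 0 fun σ => σ.fold min 1 x

theorem continuous_fold_min {X : Type*} [TopologicalSpace X] (σ : Finset α) {c : X → ℝ}
    {f : X → α → ℝ} (hc : Continuous c) (hf : Continuous f) :
    Continuous fun z => σ.fold min (c z) (f z) := by
  classical
  induction σ using Finset.induction_on with
  | empty => simpa using hc
  | insert a s ha ih =>
    simp only [Finset.fold_insert ha]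
    exact ((continuous_apply a).comp hf).min ih

theorem continuous_fold_max {X : Type*} [TopologicalSpace X] {β : Type*} (s : Finset β)
    {f : X → β → ℝ} (hf : ∀ b, Continuous fun z => f z b) :
    Continuous fun z => s.fold max 0 (f z) := by
  classical
  induction s using Finset.induction_on with
  | empty => simpa using continuous_const
  | insert a s ha ih =>
    simp only [Finset.fold_insert ha]
    exact (hf a).max ih

variable (F : Finset (Finset α))

theorem continuous_depth : Continuous (depth F) :=
  continuous_fold_max _ fun σ => continuous_fold_min σ continuous_const continuous_id

theorem continuous_shrinkage (a : α) :
    Continuous fun z : ℝ × (α → ℝ) => shrinkage F z.1 z.2 a :=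
  continuous_fold_max _ fun σ => continuous_fold_min σ continuous_fst continuous_snd

variable {F} {c : ℝ} {x : α → ℝ} {a : α}

theorem depth_nonneg : 0 ≤ depth F x :=
  (Finset.le_fold_max _).2 (Or.inl le_rfl)

theorem shrinkage_nonneg : 0 ≤ shrinkage F c x a :=
  (Finset.le_fold_max _).2 (Or.inl le_rfl)

theorem shrinkage_le (hc : 0 ≤ c) : shrinkage F c x a ≤ c :=
  (Finset.fold_max_le _).2 ⟨hc, fun _ _ => (Finset.fold_min_le _).2 (Or.inl le_rfl)⟩

theorem shrinkage_le_self (hx : 0 ≤ x a) : shrinkage F c x a ≤ x a := by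
  classical
  exact (Finset.fold_max_le _).2 ⟨hx, fun _ hσ =>
    (Finset.fold_min_le _).2 (Or.inr ⟨a, (Finset.mem_filter.1 hσ).2, le_rfl⟩)⟩

theorem exists_mem_of_shrinkage_ne_zero (h : shrinkage F c x a ≠ 0) : ∃ σ ∈ F, a ∈ σ := by
  classical
  contrapose! h
  rw [shrinkage, Finset.filter_false_of_mem h, Finset.fold_empty]

theorem shrinkage_zero : shrinkage F 0 x a = 0 :=
  le_antisymm (shrinkage_le le_rfl) shrinkage_nonneg

theorem shrinkage_of_forall (h : ∀ σ ∈ F, ∃ b ∈ σ, x b = 0) : shrinkage F c x a = 0 := by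
  classical
  exact le_antisymm ((Finset.fold_max_le _).2 ⟨le_rfl, fun σ hσ =>
    (Finset.fold_min_le _).2 <| Or.inr <|
      (h σ (Finset.mem_filter.1 hσ).1).imp fun _ hb => ⟨hb.1, hb.2.le⟩⟩) shrinkage_nonneg

theorem depth_of_forall (h : ∀ σ ∈ F, ∃ b ∈ σ, x b = 0) : depth F x = 0 :=
  le_antisymm ((Finset.fold_max_le _).2 ⟨le_rfl, fun σ hσ =>
    (Finset.fold_min_le _).2 <| Or.inr <| (h σ hσ).imp fun _ hb => ⟨hb.1, hb.2.le⟩⟩) depth_nonneg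

theorem exists_shrinkage_eq_self (hx : ∀ a, 0 ≤ x a) (hc : c ≤ 1) (h : depth F x < c) :
    ∀ σ ∈ F, ∃ b ∈ σ, shrinkage F c x b = x b := by
  intro σ hσ
  have hlt : σ.fold min 1 x < c :=
    lt_of_le_of_lt ((Finset.le_fold_max _).2 (Or.inr ⟨σ, hσ, le_rfl⟩)) h
  obtain ⟨a, ha, hac⟩ := ((Finset.fold_min_lt _).1 hlt).resolve_left (not_lt.2 hc)
  obtain ⟨b, hb, hmin⟩ := σ.exists_min_image x ⟨a, ha⟩
  refine ⟨b, hb, le_antisymm (shrinkage_le_self (hx b))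
    ((Finset.le_fold_max _).2 (Or.inr ⟨σ, ?_, ?_⟩))⟩
  · simp [hσ, hb]
  · exact (Finset.le_fold_min _).2 ⟨(hmin a ha).trans hac.le, hmin⟩

variable (F) in
/-- A bound for shrinkages which guarantees that at least half of the total mass is left. -/
noncomputable def maxShrinkage : ℝ := (2 * (∑ σ ∈ F, (σ.card : ℝ) + 1))⁻¹

theorem maxShrinkage_pos : 0 < maxShrinkage F := by
  unfold maxShrinkage; positivity

theorem maxShrinkage_le_one : maxShrinkage F ≤ 1 := by
  have : (0 : ℝ) ≤ ∑ σ ∈ F, (σ.card : ℝ) := by positivity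
  unfold maxShrinkage
  exact inv_le_one_of_one_le₀ (by linarith)

variable (F) in
open Classical in
/-- The total shrinkage. -/
noncomputable def totalShrinkage (c : ℝ) (x : α → ℝ) : ℝ :=
  ∑ a ∈ F.biUnion id, shrinkage F c x a

theorem totalShrinkage_le_half (hc : 0 ≤ c) (hcF : c ≤ maxShrinkage F) :
    totalShrinkage F c x ≤ 1 / 2 := by
  classical
  have hcard : ((F.biUnion id).card : ℝ) ≤ ∑ σ ∈ F, (σ.card : ℝ) := by
    exact_mod_cast Finset.card_biUnion_le
  have hpos : (0 : ℝ) ≤ ∑ σ ∈ F, (σ.card : ℝ) := by positivity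
  calc totalShrinkage F c x ≤ ∑ a ∈ F.biUnion id, c := Finset.sum_le_sum fun a _ => shrinkage_le hc
    _ = (F.biUnion id).card * c := by simp
    _ ≤ (∑ σ ∈ F, (σ.card : ℝ) + 1) * maxShrinkage F := by
        gcongr
        linarith
    _ = 1 / 2 := by
        unfold maxShrinkage
        field_simp

variable {K : Set (Finset α)}

theorem sum_shrinkage (hx : ∀ a, 0 ≤ x a) {s : Finset α} (hs : ∀ a, x a ≠ 0 → a ∈ s) :
    ∑ a ∈ s, shrinkage F c x a = totalShrinkage F c x := by
  classical
  have key : ∀ t : Finset α, (∀ a, shrinkage F c x a ≠ 0 → a ∈ t) →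
      ∑ a ∈ t, shrinkage F c x a = ∑ᶠ a, shrinkage F c x a := fun t ht =>
    (finsum_eq_sum_of_support_subset _ fun a ha => ht a ha).symm
  rw [totalShrinkage, key, key]
  · intro a ha
    simpa using exists_mem_of_shrinkage_ne_zero ha
  · intro a ha
    refine hs a fun h0 => ha (le_antisymm ?_ shrinkage_nonneg)
    exact h0 ▸ shrinkage_le_self (hx a)

/-- Shrink the simplices of `F` and renormalize. -/
noncomputable def push (F : Finset (Finset α)) (c : ℝ) (x : α → ℝ) (a : α) : ℝ :=
  (x a - shrinkage F c x a) / (1 - totalShrinkage F c x)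

theorem push_mem (hc : 0 ≤ c) (hcF : c ≤ maxShrinkage F) (x : Realization K) :
    (∀ a, 0 ≤ push F c x.1 a) ∧
      ∃ s ∈ K, (∀ a, push F c x.1 a ≠ 0 → a ∈ s) ∧ ∑ a ∈ s, push F c x.1 a = 1 := by
  obtain ⟨x, hx, s, hs, hsupp, hsum⟩ := x
  have hhalf := totalShrinkage_le_half (x := x) hc hcF
  refine ⟨fun a => div_nonneg (sub_nonneg.2 (shrinkage_le_self (hx a))) (by linarith),
    s, hs, fun a ha => hsupp a fun h0 => ha ?_, ?_⟩
  · have : shrinkage F c x a = 0 :=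
      le_antisymm (h0 ▸ shrinkage_le_self (hx a)) shrinkage_nonneg
    simp [push, h0, this]
  · simp only [push]
    rw [← Finset.sum_div, Finset.sum_sub_distrib, hsum, sum_shrinkage hx hsupp]
    exact div_self (by linarith)

theorem push_eq_self (h : ∀ a, shrinkage F c x a = 0) : push F c x = x := by
  ext a
  simp [push, totalShrinkage, h]

theorem mem_range_incl_iff (hK : IsLowerSet K) (F : Finset (Finset α)) (x : Realization K) :
    x ∈ Set.range (Realization.incl (avoiding_subset K F)) ↔ ∀ σ ∈ F, ∃ b ∈ σ, x.1 b = 0 := by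
  constructor
  · rintro ⟨y, rfl⟩ σ hσ
    obtain ⟨s, hs, hsupp, -⟩ := y.2.2
    have := hs.2 σ hσ
    obtain ⟨b, hb, hbs⟩ := Finset.not_subset.1 this
    exact ⟨b, hb, by_contra fun h => hbs (hsupp b h)⟩
  · intro h
    obtain ⟨s, hs, hsupp, hsum⟩ := x.exists_support hK
    refine ⟨⟨x.1, x.2.1, s, ⟨hs, fun σ hσ hσs => ?_⟩, fun a => (hsupp a).1, hsum⟩, rfl⟩
    obtain ⟨b, hb, hb0⟩ := h σ hσ
    exact (hsupp b).2 (hσs hb) hb0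

theorem isClosedEmbedding_incl_avoiding (hK : IsLowerSet K) (F : Finset (Finset α)) :
    IsClosedEmbedding (Realization.incl (avoiding_subset K F)) := by
  refine ⟨Realization.isEmbedding_incl _, ?_⟩
  have : Set.range (Realization.incl (avoiding_subset K F)) =
      ⋂ σ ∈ F, ⋃ b ∈ σ, {x : Realization K | x.1 b = 0} := by
    ext x
    rw [mem_range_incl_iff hK]
    simp
  rw [this]
  refine isClosed_biInter fun σ _ => Set.Finite.isClosed_biUnion σ.finite_toSet fun b _ => ?_
  exact isClosed_eq ((continuous_apply b).comp continuous_subtype_val) continuous_const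

theorem isClosedEmbedding_incl {L : Set (Finset α)} (hK : IsLowerSet K)
    (hLK : L ⊆ K) (hL : L = avoiding K F) : IsClosedEmbedding (Realization.incl hLK) := by
  subst hL
  exact isClosedEmbedding_incl_avoiding hK F

/-- The retraction of `|K| × [0, 1]` onto the union of `|K| × {0}` and the cylinder on the
subcomplex avoiding `F`. -/
noncomputable def cylinderRetraction (K : Set (Finset α)) (F : Finset (Finset α)) :
    C(Realization K × unitInterval, Realization K × unitInterval) where
  toFun z := (⟨push F (maxShrinkage F * z.2) z.1.1,
      push_mem (mul_nonneg maxShrinkage_pos.le z.2.2.1)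
        (mul_le_of_le_one_right maxShrinkage_pos.le z.2.2.2) z.1⟩,
    Set.projIcc 0 1 zero_le_one (z.2 - depth F z.1.1 / maxShrinkage F))
  continuous_toFun := by
    have hshrink : ∀ a, Continuous fun z : Realization K × unitInterval =>
        shrinkage F (maxShrinkage F * z.2) z.1.1 a := fun a =>
      (continuous_shrinkage F a).comp
        (by fun_prop : Continuous fun z : Realization K × unitInterval =>
          ((maxShrinkage F * z.2 : ℝ), z.1.1))
    refine .prodMk (Continuous.subtype_mk (continuous_pi fun a => ?_) _) ?_
    · refine Continuous.div ?_ ?_ fun z => ?_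
      · exact ((continuous_apply a).comp
          (by fun_prop : Continuous fun z : Realization K × unitInterval => z.1.1)).sub (hshrink a)
      · exact continuous_const.sub (continuous_finsetSum _ fun a _ => hshrink a)
      · have := totalShrinkage_le_half (F := F) (x := z.1.1)
          (mul_nonneg maxShrinkage_pos.le z.2.2.1)
          (mul_le_of_le_one_right maxShrinkage_pos.le z.2.2.2)
        linarith
    · refine continuous_projIcc.comp (.sub (by fun_prop) (.div_const ?_ _))
      exact (continuous_depth F).comp (by fun_prop)

theorem cylinderRetraction_zero (x : Realization K) :
    cylinderRetraction K F (x, 0) = (x, 0) := by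
  refine Prod.ext (Subtype.ext ?_) ?_
  · refine push_eq_self fun a => ?_
    simpa using shrinkage_zero
  · refine Set.projIcc_of_le_left zero_le_one ?_
    have := div_nonneg (depth_nonneg (F := F) (x := x.1)) (maxShrinkage_pos (F := F)).le
    simpa using this

theorem cylinderRetraction_incl (hK : IsLowerSet K) (y : Realization (avoiding K F))
    (s : unitInterval) :
    cylinderRetraction K F (Realization.incl (avoiding_subset K F) y, s) =
      (Realization.incl (avoiding_subset K F) y, s) := by
  have h := (mem_range_incl_iff hK F _).1 ⟨y, rfl⟩
  refine Prod.ext (Subtype.ext (push_eq_self fun a => shrinkage_of_forall h)) ?_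
  simp [cylinderRetraction, depth_of_forall h]

theorem cylinderRetraction_mem (hK : IsLowerSet K) (z : Realization K × unitInterval) :
    (cylinderRetraction K F z).2 = 0 ∨
      (cylinderRetraction K F z).1 ∈ Set.range (Realization.incl (avoiding_subset K F)) := by
  obtain ⟨x, s⟩ := z
  rcases le_or_gt ((s : ℝ) - depth F x.1 / maxShrinkage F) 0 with h | h
  · exact Or.inl (Set.projIcc_of_le_left zero_le_one h)
  · right
    rw [mem_range_incl_iff hK]
    have hlt : depth F x.1 < maxShrinkage F * s := by
      rw [sub_pos, div_lt_iff₀ maxShrinkage_pos] at h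
      linarith
    intro σ hσ
    obtain ⟨b, hb, hbx⟩ := exists_shrinkage_eq_self x.2.1
      (mul_le_one₀ maxShrinkage_le_one s.2.1 s.2.2) hlt σ hσ
    exact ⟨b, hb, by simp [cylinderRetraction, push, hbx]⟩

/-- Collapsing a contractible subcomplex, given by finitely many minimal non-faces, is a homotopy
equivalence. -/
theorem Realization.homotopyEquiv_of_collapse (hK : IsLowerSet K) (F : Finset (Finset α))
    [ContractibleSpace (Realization (avoiding K F))] {Y : Type*} [TopologicalSpace Y]
    (q : C(Realization K, Y)) (hq : IsQuotientMap q)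
    (hfib : ∀ x y, q x = q y ↔ x = y ∨
      ((∀ σ ∈ F, ∃ b ∈ σ, x.1 b = 0) ∧ (∀ σ ∈ F, ∃ b ∈ σ, y.1 b = 0))) :
    Nonempty (ContinuousMap.HomotopyEquiv (Realization K) Y) :=
  _root_.homotopyEquiv_of_collapse (isClosedEmbedding_incl_avoiding hK F)
    (cylinderRetraction K F) cylinderRetraction_zero (cylinderRetraction_incl hK)
    (cylinderRetraction_mem hK) q hq (by simpa only [mem_range_incl_iff hK] using hfib)

end Retraction

theorem Quot.mk_eq_mk_iff_of_collapse {β : Type*} {r : β → β → Prop} {P : β → Prop}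
    (hr : ∀ a b, r a b ↔ P a ∧ P b) (a b : β) :
    Quot.mk r a = Quot.mk r b ↔ a = b ∨ (P a ∧ P b) := by
  constructor
  · intro h
    replace h := Quot.eqvGen_exact h
    induction h with
    | rel _ _ h => exact Or.inr ((hr _ _).1 h)
    | refl => exact Or.inl rfl
    | symm _ _ _ ih => exact ih.imp Eq.symm And.symm
    | trans _ _ _ _ _ ih₁ ih₂ => grind
  · rintro (rfl | h)
    · rfl
    · exact Quot.sound ((hr _ _).2 h)

section Contractible

variable {α : Type*} [DecidableEq α] {K : Set (Finset α)} {v : α}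

/-- The realization of a cone is contractible. -/
theorem contractibleSpace_of_cone (hne : K.Nonempty) (h : ∀ s ∈ K, insert v s ∈ K) :
    ContractibleSpace (Realization K) := by
  have hsum : ∀ s : Finset α, ∑ a ∈ insert v s, (Pi.single v 1 : α → ℝ) a = 1 := fun s => by
    simp
  have hsupp : ∀ (s : Finset α) a, (Pi.single v 1 : α → ℝ) a ≠ 0 → a ∈ insert v s := by
    intro s a ha
    rw [Finset.mem_insert]
    by_contra! hav
    exact ha (Pi.single_eq_of_ne hav.1 1)
  have hnn : ∀ a, 0 ≤ (Pi.single v 1 : α → ℝ) a := fun a => by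
    by_cases hav : a = v
    · subst hav; simp
    · simp [Pi.single_eq_of_ne hav]
  rw [contractible_iff_id_nullhomotopic]
  obtain ⟨s₀, hs₀⟩ := hne
  refine ⟨⟨Pi.single v 1, hnn, insert v s₀, h _ hs₀, hsupp s₀, hsum s₀⟩, ⟨⟨⟨fun z =>
    ⟨fun a => (1 - (z.1 : ℝ)) * z.2.1 a + z.1 * (Pi.single v 1 : α → ℝ) a, fun a => ?_, ?_⟩, ?_⟩,
    fun x => ?_, fun x => ?_⟩⟩⟩
  · have := z.1.2.1
    have := z.1.2.2
    have := z.2.2.1 a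
    have := hnn a
    have : 0 ≤ 1 - (z.1 : ℝ) := by linarith
    positivity
  · obtain ⟨s, hs, hxs, hxsum⟩ := z.2.2.2
    refine ⟨insert v s, h s hs, fun a ha => ?_, ?_⟩
    · by_contra hn
      have h₁ : z.2.1 a = 0 := by_contra fun h' => hn (Finset.mem_insert_of_mem (hxs a h'))
      have h₂ : (Pi.single v 1 : α → ℝ) a = 0 := by_contra fun h' => hn (hsupp s a h')
      exact ha (by simp only [h₁, h₂]; ring)
    · have h₁ : ∑ a ∈ insert v s, z.2.1 a = 1 := by
        refine (Finset.sum_subset (Finset.subset_insert v s) fun a _ ha => ?_).symm.trans hxsum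
        exact by_contra fun h' => ha (hxs a h')
      rw [Finset.sum_add_distrib, ← Finset.mul_sum, ← Finset.mul_sum, h₁, hsum]
      ring
  · refine Continuous.subtype_mk (continuous_pi fun a => ?_) _
    have : Continuous fun z : unitInterval × Realization K => z.2.1 a :=
      (continuous_apply a).comp
        (by fun_prop : Continuous fun z : unitInterval × Realization K => z.2.1)
    fun_prop
  · ext a; simp
  · ext a; simp

/-- The link of a vertex. -/
def link (K : Set (Finset α)) (v : α) : Set (Finset α) := {s | v ∉ s ∧ insert v s ∈ K}

/-- The closed star of a vertex. -/
def closedStar (K : Set (Finset α)) (v : α) : Set (Finset α) := {s | s ∈ K ∧ insert v s ∈ K}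

theorem IsLowerSet.closedStar (hK : IsLowerSet K) (v : α) : IsLowerSet (closedStar K v) :=
  fun _ _ h hs => ⟨hK h hs.1, hK (Finset.insert_subset_insert v h) hs.2⟩

theorem avoiding_closedStar (hK : IsLowerSet K) : avoiding (closedStar K v) {{v}} = link K v := by
  ext s
  simp only [avoiding, closedStar, link, Finset.mem_singleton, forall_eq,
    Finset.singleton_subset_iff,
    Set.mem_ofPred_eq]
  exact ⟨fun h => ⟨h.2, h.1.2⟩, fun h => ⟨⟨hK (Finset.subset_insert v s) h.2, h.2⟩, h.1⟩⟩

theorem closedStar_eq_avoiding (hK : IsLowerSet K) (hfin : K.Finite) :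
    ∃ F, closedStar K v = avoiding K F := by
  classical
  refine ⟨hfin.toFinset.filter (insert v · ∉ K), ?_⟩
  ext s
  simp only [closedStar, avoiding, Finset.mem_filter, Set.Finite.mem_toFinset, Set.mem_ofPred_eq]
  refine and_congr_right fun hs => ⟨fun h σ hσ hσs => ?_, fun h => ?_⟩
  · exact hσ.2 (hK (Finset.insert_subset_insert v hσs) h)
  · by_contra h'
    exact h s ⟨hs, h'⟩ subset_rfl

/-- A complex is contractible as soon as the deletion of a vertex is contractible and its link is
void or contractible. -/
theorem contractibleSpace_of_link_of_deletion (hK : IsLowerSet K) (hfin : K.Finite)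
    (hdel : ContractibleSpace (Realization (avoiding K {{v}})))
    (hlink : link K v = ∅ ∨ ContractibleSpace (Realization (link K v))) :
    ContractibleSpace (Realization K) := by
  classical
  rcases hlink with hlink | hlink
  · have : avoiding K {{v}} = K := by
      refine Set.Subset.antisymm (avoiding_subset _ _) fun s hs => ⟨hs, fun σ hσ hσs => ?_⟩
      rw [Finset.mem_singleton] at hσ
      subst hσ
      have hv : v ∈ s := Finset.singleton_subset_iff.1 hσs
      have : s.erase v ∈ link K v := ⟨by simp, by rwa [Finset.insert_erase hv]⟩
      simp [hlink] at this
    rwa [this] at hdel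
  have hcone : ContractibleSpace (Realization (closedStar K v)) := by
    obtain ⟨y⟩ := (inferInstance : Nonempty (Realization (link K v)))
    obtain ⟨s, hs, -⟩ := y.2.2
    exact contractibleSpace_of_cone (v := v) ⟨s, hK (Finset.subset_insert v s) hs.2, hs.2⟩
      fun s hs => ⟨hs.2, by simpa using hs.2⟩
  rw [← avoiding_closedStar hK] at hlink
  obtain ⟨y₀⟩ := (inferInstance : Nonempty (Realization (avoiding (closedStar K v) {{v}})))
  let x₀ : Realization (closedStar K v) := Realization.incl (avoiding_subset _ _) y₀
  have hx₀ : x₀.1 v = 0 := by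
    simpa using (mem_range_incl_iff (hK.closedStar v) {{v}} x₀).1 ⟨y₀, rfl⟩
  let r : Realization (closedStar K v) → Realization (closedStar K v) → Prop :=
    fun x y => x.1 v = 0 ∧ y.1 v = 0
  have hr := Quot.mk_eq_mk_iff_of_collapse (r := r) (fun _ _ => Iff.rfl)
  have hstar : closedStar K v ⊆ K := fun _ h => h.1
  have hmem : ∀ x : Realization K, x.1 v ≠ 0 →
      (∀ a, 0 ≤ x.1 a) ∧ ∃ s ∈ closedStar K v, (∀ a, x.1 a ≠ 0 → a ∈ s) ∧ ∑ a ∈ s, x.1 a = 1 := by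
    rintro ⟨x, hx, s, hs, hsupp, hsum⟩ hxv
    exact ⟨hx, s, ⟨hs, by rwa [Finset.insert_eq_self.2 (hsupp v hxv)]⟩, hsupp, hsum⟩
  let q : Realization K → Quot r := fun x =>
    if h : x.1 v ≠ 0 then Quot.mk r ⟨x.1, hmem x h⟩ else Quot.mk r x₀
  have hq_incl : ∀ y, q (Realization.incl hstar y) = Quot.mk r y := by
    intro y
    by_cases h : y.1 v = 0
    · have : q (Realization.incl hstar y) = Quot.mk r x₀ := dif_neg (not_not.2 h)
      rw [this, hr]
      exact Or.inr ⟨hx₀, h⟩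
    · exact dif_pos h
  have hstar_closed : IsClosedEmbedding (Realization.incl hstar) := by
    obtain ⟨F, hF⟩ := closedStar_eq_avoiding (v := v) hK hfin
    exact isClosedEmbedding_incl hK hstar hF
  have hq : Continuous q := by
    have hcover : ({x : Realization K | x.1 v = 0} ∪ Set.range (Realization.incl hstar)) =
        Set.univ := by
      refine Set.eq_univ_of_forall fun x => or_iff_not_imp_left.2 fun h => ⟨⟨x.1, hmem x h⟩, rfl⟩
    rw [← continuousOn_univ, ← hcover]
    refine ContinuousOn.union_of_isClosed ?_ ?_ ?_ hstar_closed.isClosed_range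
    · refine (continuousOn_const (c := Quot.mk r x₀)).congr fun x hx => dif_neg (not_not.2 hx)
    · rw [← Set.image_univ, hstar_closed.isInducing.continuousOn_image_iff]
      have : q ∘ Realization.incl hstar = Quot.mk r := funext hq_incl
      rw [this]
      exact continuous_quot_mk.continuousOn
    · exact isClosed_eq ((continuous_apply v).comp continuous_subtype_val) continuous_const
  have hqq : IsQuotientMap q := by
    refine IsQuotientMap.of_comp hstar_closed.continuous hq ?_
    have : q ∘ Realization.incl hstar = Quot.mk r := funext hq_incl
    rw [this]
    exact isQuotientMap_quot_mk
  obtain ⟨e₁⟩ := Realization.homotopyEquiv_of_collapse (hK.closedStar v) {{v}}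
    ⟨Quot.mk r, continuous_quot_mk⟩ isQuotientMap_quot_mk (by simpa using hr)
  obtain ⟨e₂⟩ := Realization.homotopyEquiv_of_collapse hK {{v}} ⟨q, hq⟩ hqq (by
    intro x y
    simp only [ContinuousMap.coe_mk, Finset.mem_singleton, forall_eq, exists_eq_left]
    by_cases hx : x.1 v = 0 <;> by_cases hy : y.1 v = 0
    · have h₁ : q x = Quot.mk r x₀ := dif_neg (not_not.2 hx)
      have h₂ : q y = Quot.mk r x₀ := dif_neg (not_not.2 hy)
      simp [h₁, h₂, hx, hy]
    · have h₁ : q x = Quot.mk r x₀ := dif_neg (not_not.2 hx)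
      have h₂ : q y = Quot.mk r ⟨y.1, hmem y hy⟩ := dif_pos hy
      rw [h₁, h₂, hr]
      constructor
      · rintro (h | h)
        · exact absurd ((congrFun (congrArg Subtype.val h) v).symm.trans hx₀) hy
        · exact absurd h.2 hy
      · rintro (rfl | h)
        · exact absurd hx hy
        · exact absurd h.2 hy
    · have h₁ : q x = Quot.mk r ⟨x.1, hmem x hx⟩ := dif_pos hx
      have h₂ : q y = Quot.mk r x₀ := dif_neg (not_not.2 hy)
      rw [h₁, h₂, hr]
      constructor
      · rintro (h | h)
        · exact absurd ((congrFun (congrArg Subtype.val h) v).trans hx₀) hx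
        · exact absurd h.1 hx
      · rintro (rfl | h)
        · exact absurd hy hx
        · exact absurd h.1 hx
    · have h₁ : q x = Quot.mk r ⟨x.1, hmem x hx⟩ := dif_pos hx
      have h₂ : q y = Quot.mk r ⟨y.1, hmem y hy⟩ := dif_pos hy
      rw [h₁, h₂, hr]
      simp [hx, Subtype.ext_iff])
  exact (e₂.trans e₁.symm).contractibleSpace

end Contractible

section SimplexToSphere

variable {d : ℕ}

/-- The smallest barycentric coordinate. -/
noncomputable def minCoord (x : Fin (d + 1) → ℝ) : ℝ :=
  Finset.univ.inf' ⟨0, Finset.mem_univ _⟩ x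

theorem minCoord_le (x : Fin (d + 1) → ℝ) (i : Fin (d + 1)) : minCoord x ≤ x i :=
  Finset.inf'_le _ (Finset.mem_univ i)

theorem exists_minCoord_eq (x : Fin (d + 1) → ℝ) : ∃ i, minCoord x = x i := by
  obtain ⟨i, -, h⟩ := Finset.exists_mem_eq_inf' (s := Finset.univ) ⟨0, Finset.mem_univ _⟩ x
  exact ⟨i, h⟩

theorem eq_minCoord {x : Fin (d + 1) → ℝ} {m : ℝ} (h : ∀ i, m ≤ x i) (h' : ∃ i, m = x i) :
    minCoord x = m := by
  obtain ⟨i, rfl⟩ := h'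
  obtain ⟨j, hj⟩ := exists_minCoord_eq x
  exact le_antisymm (minCoord_le x i) (hj ▸ h j)

theorem continuous_minCoord : Continuous (minCoord (d := d)) :=
  Continuous.finset_inf'_apply _ fun i _ => continuous_apply i

/-- The squared length of the differences of the coordinates with the coordinate `0`. -/
noncomputable def spread (x : Fin (d + 1) → ℝ) : ℝ := ∑ i : Fin d, (x i.succ - x 0) ^ 2

theorem spread_nonneg (x : Fin (d + 1) → ℝ) : 0 ≤ spread x :=
  Finset.sum_nonneg fun _ _ => sq_nonneg _

theorem spread_add_sq_pos (x : stdSimplex ℝ (Fin (d + 1))) :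
    0 < spread x.1 + minCoord x.1 ^ 2 := by
  by_contra! h
  have h₁ := spread_nonneg x.1
  have h₂ := sq_nonneg (minCoord x.1)
  have hs : spread x.1 = 0 := by linarith
  have hm : minCoord x.1 = 0 := by
    have : minCoord x.1 ^ 2 = 0 := by linarith
    exact pow_eq_zero_iff two_ne_zero |>.1 this
  have hall : ∀ i, x.1 i = x.1 0 := by
    refine Fin.cases rfl fun i => ?_
    have := (Finset.sum_eq_zero_iff_of_nonneg fun _ _ => sq_nonneg _).1 hs i (Finset.mem_univ i)
    exact sub_eq_zero.1 (pow_eq_zero_iff two_ne_zero |>.1 this)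
  obtain ⟨j, hj⟩ := exists_minCoord_eq x.1
  have hzero : ∀ i, x.1 i = 0 := fun i => by rw [hall i, ← hall j, ← hj, hm]
  have := x.2.2
  simp [hzero] at this

/-- The map from the simplex to the sphere that collapses the boundary to the basepoint. -/
noncomputable def simplexToSphere (x : stdSimplex ℝ (Fin (d + 1))) : SphereD d :=
  ⟨WithLp.toLp 2 (Fin.cons ((spread x.1 - minCoord x.1 ^ 2) / (spread x.1 + minCoord x.1 ^ 2))
    fun i => 2 * minCoord x.1 * (x.1 i.succ - x.1 0) / (spread x.1 + minCoord x.1 ^ 2)), by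
    have hN := spread_add_sq_pos x
    rw [mem_sphere_zero_iff_norm, EuclideanSpace.norm_eq, Real.sqrt_eq_one, Fin.sum_univ_succ]
    simp only [Fin.cons_zero, Fin.cons_succ, Real.norm_eq_abs, sq_abs, div_pow, mul_pow]
    rw [← Finset.sum_div, ← Finset.mul_sum, ← add_div, div_eq_one_iff_eq (by positivity)]
    change _ + _ * spread x.1 = _
    ring⟩

theorem simplexToSphere_zero (x : stdSimplex ℝ (Fin (d + 1))) : (simplexToSphere x).1 0 =
    (spread x.1 - minCoord x.1 ^ 2) / (spread x.1 + minCoord x.1 ^ 2) := rfl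

theorem simplexToSphere_succ (x : stdSimplex ℝ (Fin (d + 1))) (i : Fin d) :
    (simplexToSphere x).1 i.succ =
      2 * minCoord x.1 * (x.1 i.succ - x.1 0) / (spread x.1 + minCoord x.1 ^ 2) := rfl

theorem SphereD.pt_zero : (SphereD.pt d).1 0 = 1 := by simp [SphereD.pt]

theorem SphereD.eq_pt_iff (p : SphereD d) : p = SphereD.pt d ↔ p.1 0 = 1 := by
  refine ⟨fun h => h ▸ SphereD.pt_zero, fun h => ?_⟩
  have hp := mem_sphere_zero_iff_norm.1 p.2
  rw [EuclideanSpace.norm_eq, Real.sqrt_eq_one, Fin.sum_univ_succ, h] at hp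
  simp only [norm_one, one_pow, add_eq_left, Real.norm_eq_abs, sq_abs] at hp
  ext i
  refine Fin.cases ?_ (fun i => ?_) i
  · rw [h, SphereD.pt_zero]
  · have := (Finset.sum_eq_zero_iff_of_nonneg fun _ _ => sq_nonneg _).1 hp i (Finset.mem_univ i)
    simpa [SphereD.pt, Fin.succ_ne_zero] using this

theorem simplexToSphere_eq_pt_iff (x : stdSimplex ℝ (Fin (d + 1))) :
    simplexToSphere x = SphereD.pt d ↔ ∃ i, x.1 i = 0 := by
  have hN := spread_add_sq_pos x
  rw [SphereD.eq_pt_iff, simplexToSphere_zero, div_eq_one_iff_eq hN.ne']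
  constructor
  · intro h
    have : minCoord x.1 ^ 2 = 0 := by linarith
    obtain ⟨i, hi⟩ := exists_minCoord_eq x.1
    exact ⟨i, hi.symm.trans (pow_eq_zero_iff two_ne_zero |>.1 this)⟩
  · rintro ⟨i, hi⟩
    rw [eq_minCoord x.2.1 ⟨i, hi.symm⟩]
    ring

theorem minCoord_pos_of_ne_pt {x : stdSimplex ℝ (Fin (d + 1))}
    (hx : simplexToSphere x ≠ SphereD.pt d) : 0 < minCoord x.1 := by
  obtain ⟨i, hi⟩ := exists_minCoord_eq x.1
  rw [Ne, simplexToSphere_eq_pt_iff, not_exists] at hx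
  rw [hi]
  exact lt_of_le_of_ne (x.2.1 i) (Ne.symm (hx i))

theorem simplexToSphere_injOn {x y : stdSimplex ℝ (Fin (d + 1))}
    (hx : simplexToSphere x ≠ SphereD.pt d) (h : simplexToSphere x = simplexToSphere y) :
    x = y := by
  have hmx := minCoord_pos_of_ne_pt hx
  have hmy := minCoord_pos_of_ne_pt (h ▸ hx)
  have hNx := spread_add_sq_pos x
  have hNy := spread_add_sq_pos y
  set m := minCoord x.1 with hm
  set m' := minCoord y.1 with hm'
  set N := spread x.1 + m ^ 2 with hN
  set N' := spread y.1 + m' ^ 2 with hN'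
  have h0 : m ^ 2 / N = m' ^ 2 / N' := by
    have := congrArg (fun z => z.1 0) h
    rw [simplexToSphere_zero, simplexToSphere_zero, ← hm, ← hm', ← hN, ← hN',
      show spread x.1 - m ^ 2 = N - 2 * m ^ 2 by rw [hN]; ring,
      show spread y.1 - m' ^ 2 = N' - 2 * m' ^ 2 by rw [hN']; ring,
      sub_div, sub_div, div_self hNx.ne', div_self hNy.ne', mul_div_assoc, mul_div_assoc] at this
    linarith
  have hdiff : ∀ i, (x.1 i - x.1 0) / m = (y.1 i - y.1 0) / m' := by
    refine Fin.cases (by simp) fun i => ?_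
    have := congrArg (fun z => z.1 i.succ) h
    rw [simplexToSphere_succ, simplexToSphere_succ, ← hm, ← hm', ← hN, ← hN'] at this
    have hpos : 0 < m ^ 2 / N := by positivity
    have hpos' : 0 < m' ^ 2 / N' := by positivity
    have h₁ : (x.1 i.succ - x.1 0) / m * (m ^ 2 / N) =
        2 * m * (x.1 i.succ - x.1 0) / N / 2 := by field_simp
    have h₂ : (y.1 i.succ - y.1 0) / m' * (m' ^ 2 / N') =
        2 * m' * (y.1 i.succ - y.1 0) / N' / 2 := by field_simp
    refine mul_right_cancel₀ hpos.ne' ?_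
    rw [h₁, h0, h₂, this]
  have hscale : ∀ i, x.1 i / m = x.1 0 / m + (x.1 i - x.1 0) / m := fun i => by ring
  have hscale' : ∀ i, y.1 i / m' = y.1 0 / m' + (x.1 i - x.1 0) / m := fun i => by
    rw [hdiff]; ring
  have hbase : x.1 0 / m = y.1 0 / m' := by
    obtain ⟨i, hi⟩ := exists_minCoord_eq x.1
    obtain ⟨j, hj⟩ := exists_minCoord_eq y.1
    have h₁ : x.1 i / m = 1 := by rw [← hi, ← hm, div_self hmx.ne']
    have h₂ : y.1 j / m' = 1 := by rw [← hj, ← hm', div_self hmy.ne']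
    have h₃ : 1 ≤ y.1 i / m' := (one_le_div hmy).2 (minCoord_le _ _)
    have h₄ : 1 ≤ x.1 j / m := (one_le_div hmx).2 (minCoord_le _ _)
    rw [hscale] at h₁ h₄
    rw [hscale'] at h₂ h₃
    linarith
  have heq : ∀ i, x.1 i / m = y.1 i / m' := fun i => by rw [hscale, hscale', hbase]
  have hmm : m = m' := by
    have h₁ : ∑ i, x.1 i / m = 1 / m := by rw [← Finset.sum_div, x.2.2]
    have h₂ : ∑ i, y.1 i / m' = 1 / m' := by rw [← Finset.sum_div, y.2.2]
    have : 1 / m = 1 / m' := by rw [← h₁, ← h₂]; exact Finset.sum_congr rfl fun i _ => heq i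
    simpa using this
  ext i
  have := heq i
  rw [hmm] at this
  exact (div_left_inj' hmy.ne').1 this

theorem simplexToSphere_surjective (hd : d ≠ 0) :
    Function.Surjective (simplexToSphere (d := d)) := by
  intro p
  by_cases hp : p = SphereD.pt d
  · obtain ⟨e, rfl⟩ := Nat.exists_eq_succ_of_ne_zero hd
    subst hp
    refine ⟨⟨Pi.single 0 1, single_mem_stdSimplex ℝ 0⟩, ?_⟩
    rw [simplexToSphere_eq_pt_iff]
    exact ⟨1, by simp⟩
  · have hp0 : p.1 0 ≠ 1 := fun h => hp ((SphereD.eq_pt_iff p).2 h)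
    have hnorm := mem_sphere_zero_iff_norm.1 p.2
    rw [EuclideanSpace.norm_eq, Real.sqrt_eq_one, Fin.sum_univ_succ] at hnorm
    simp only [Real.norm_eq_abs, sq_abs] at hnorm
    have hs : 1 - p.1 0 ≠ 0 := sub_ne_zero.2 hp0.symm
    let y : Fin (d + 1) → ℝ := Fin.cons 0 fun i => p.1 i.succ / (1 - p.1 0)
    let z : Fin (d + 1) → ℝ := fun i => y i - minCoord y + 1
    have hz : ∀ i, 1 ≤ z i := fun i => by
      have := minCoord_le y i
      simp only [z]; linarith
    have hS : 0 < ∑ i, z i := Finset.sum_pos (fun i _ => by linarith [hz i]) ⟨0, Finset.mem_univ _⟩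
    set c : ℝ := (∑ i, z i)⁻¹ with hc
    have hc0 : 0 < c := inv_pos.2 hS
    let x : stdSimplex ℝ (Fin (d + 1)) := ⟨fun i => c * z i,
      fun i => mul_nonneg hc0.le (by linarith [hz i]), by
        rw [← Finset.mul_sum, hc, inv_mul_cancel₀ hS.ne']⟩
    have hmin : minCoord x.1 = c := by
      refine eq_minCoord (fun i => le_mul_of_one_le_right hc0.le (hz i)) ?_
      obtain ⟨i, hi⟩ := exists_minCoord_eq y
      exact ⟨i, by simp [x, z, hi]⟩
    have hx0 : ∀ i : Fin d, x.1 i.succ - x.1 0 = c * (p.1 i.succ / (1 - p.1 0)) := fun i => by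
      simp only [x, z, y, Fin.cons_succ, Fin.cons_zero]; ring
    have hspread : spread x.1 = c ^ 2 * ((1 + p.1 0) / (1 - p.1 0)) := by
      have : ∑ i : Fin d, p.1 i.succ ^ 2 = (1 - p.1 0) * (1 + p.1 0) := by linarith
      simp only [spread, hx0, mul_pow, div_pow]
      rw [← Finset.mul_sum, ← Finset.sum_div, this]
      field_simp
    have hN : spread x.1 + minCoord x.1 ^ 2 = c ^ 2 * (2 / (1 - p.1 0)) := by
      rw [hspread, hmin]
      field_simp
      ring
    refine ⟨x, ?_⟩
    ext i
    refine Fin.cases ?_ (fun i => ?_) i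
    · rw [simplexToSphere_zero, hN, hspread, hmin]
      field_simp
      ring
    · rw [simplexToSphere_succ, hN, hmin, hx0]
      field_simp

theorem continuous_simplexToSphere : Continuous (simplexToSphere (d := d)) := by
  have hcoord (i) : Continuous fun x : stdSimplex ℝ (Fin (d + 1)) => x.1 i :=
    (continuous_apply i).comp continuous_subtype_val
  have hspread : Continuous fun x : stdSimplex ℝ (Fin (d + 1)) => spread x.1 := by
    exact continuous_finsetSum _ fun i _ => ((hcoord _).sub (hcoord _)).pow 2
  have hmin : Continuous fun x : stdSimplex ℝ (Fin (d + 1)) => minCoord x.1 :=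
    continuous_minCoord.comp continuous_subtype_val
  have hN : ∀ x : stdSimplex ℝ (Fin (d + 1)), spread x.1 + minCoord x.1 ^ 2 ≠ 0 :=
    fun x => (spread_add_sq_pos x).ne'
  refine Continuous.subtype_mk ((PiLp.continuous_toLp 2 _).comp (continuous_pi fun i => ?_)) _
  refine Fin.cases ?_ (fun i => ?_) i
  · simp only [Fin.cons_zero]
    exact (hspread.sub (hmin.pow 2)).div (hspread.add (hmin.pow 2)) hN
  · simp only [Fin.cons_succ]
    exact ((continuous_const.mul hmin).mul ((hcoord _).sub (hcoord _))).div
      (hspread.add (hmin.pow 2)) hN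

end SimplexToSphere

section Wedge

variable {α : Type*} {K : Set (Finset α)} {d : ℕ}

open Classical in
/-- The parametrization of a face of the realization by the standard simplex. -/
noncomputable def faceMap {σ : Finset α} (hσ : σ ∈ K) (e : Fin (d + 1) ≃ σ)
    (u : stdSimplex ℝ (Fin (d + 1))) : Realization K :=
  ⟨fun a => if h : a ∈ σ then u.1 (e.symm ⟨a, h⟩) else 0, fun a => by
    dsimp only
    split_ifs
    exacts [u.2.1 _, le_rfl], σ, hσ, fun a => by simp +contextual, by
    rw [← Finset.sum_coe_sort, ← u.2.2, ← e.sum_comp]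
    simp⟩

variable {σ : Finset α} {hσ : σ ∈ K} {e : Fin (d + 1) ≃ σ}

theorem faceMap_apply (u : stdSimplex ℝ (Fin (d + 1))) (k : Fin (d + 1)) :
    (faceMap hσ e u).1 (e k) = u.1 k := by simp [faceMap]

theorem mem_of_faceMap_ne_zero {u : stdSimplex ℝ (Fin (d + 1))} {a : α}
    (h : (faceMap hσ e u).1 a ≠ 0) : a ∈ σ := by
  by_contra ha
  exact h (dif_neg ha)

theorem faceMap_injective : Function.Injective (faceMap hσ e) := fun u w h => by
  ext k
  change u.1 k = w.1 k
  rw [← faceMap_apply (hσ := hσ) (e := e) u, h, faceMap_apply]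

theorem continuous_faceMap : Continuous (faceMap hσ e) := by
  refine Continuous.subtype_mk (continuous_pi fun a => ?_) _
  split_ifs
  exacts [(continuous_apply _).comp continuous_subtype_val, continuous_const]

theorem exists_faceMap_eq_zero_iff (u : stdSimplex ℝ (Fin (d + 1))) :
    (∃ b ∈ σ, (faceMap hσ e u).1 b = 0) ↔ ∃ k, u.1 k = 0 := by
  constructor
  · rintro ⟨b, hb, h⟩
    obtain ⟨k, hk⟩ := e.surjective ⟨b, hb⟩
    exact ⟨k, by rw [← faceMap_apply (hσ := hσ) (e := e), hk, h]⟩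
  · rintro ⟨k, hk⟩
    exact ⟨e k, (e k).2, by rw [faceMap_apply, hk]⟩

theorem mem_range_faceMap (hK : IsLowerSet K) (hmax : ∀ s ∈ K, σ ⊆ s → s = σ)
    {x : Realization K} (hx : ∀ b ∈ σ, x.1 b ≠ 0) : x ∈ Set.range (faceMap hσ e) := by
  obtain ⟨s, hs, hsupp, hsum⟩ := x.exists_support hK
  obtain rfl := hmax s hs fun b hb => (hsupp b).1 (hx b hb)
  refine ⟨⟨fun k => x.1 (e k), fun k => x.2.1 _, ?_⟩, ?_⟩
  · rw [← Finset.sum_coe_sort, ← e.sum_comp] at hsum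
    exact hsum
  · ext a
    by_cases ha : a ∈ s
    · obtain ⟨k, hk⟩ := e.surjective ⟨a, ha⟩
      obtain rfl : (e k : α) = a := by rw [hk]
      rw [faceMap_apply]
    · rw [by_contra fun h => ha (mem_of_faceMap_ne_zero h),
        by_contra fun h => ha ((hsupp a).1 h)]

/-- A complex that becomes contractible when some of its facets, all of them of dimension `d`, are
removed is homotopy equivalent to a wedge of `d`-spheres. -/
theorem homotopyEquiv_wedgeOfSpheres {ι : Type*} [Finite ι] (hd : d ≠ 0) (hK : IsLowerSet K)
    {σ : ι → Finset α} {F : Finset (Finset α)} (hF : ∀ s, s ∈ F ↔ ∃ i, σ i = s)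
    (hσK : ∀ i, σ i ∈ K)
    (hcard : ∀ i, (σ i).card = d + 1) (hmax : ∀ i, ∀ s ∈ K, σ i ⊆ s → s = σ i)
    (hinj : Function.Injective σ) [hL : ContractibleSpace (Realization (avoiding K F))] :
    Nonempty (ContinuousMap.HomotopyEquiv (Realization K)
      (WedgeOfSpheres fun _ : ι => d)) := by
  let e (i) : Fin (d + 1) ≃ σ i := (Finset.equivFinOfCardEq (hcard i)).symm
  let φ (i) := faceMap (hσK i) (e i)
  let D (x : Realization K) : Prop := ∀ τ ∈ F, ∃ b ∈ τ, x.1 b = 0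
  let W := (Σ _ : ι, SphereD d) ⊕ Unit
  let P (p : W) : Prop := p = Sum.inr () ∨ ∃ i, p = Sum.inl ⟨i, SphereD.pt d⟩
  let X := (Σ _ : ι, stdSimplex ℝ (Fin (d + 1))) ⊕ Realization (avoiding K F)
  let π : X → Realization K :=
    Sum.elim (fun z => φ z.1 z.2) (Realization.incl (avoiding_subset K F))
  let f : X → W := Sum.map (Sigma.map id fun _ => simplexToSphere) fun _ => ()
  let g : X → WedgeOfSpheres fun _ : ι => d := fun z => Quot.mk _ (f z)
  have hcompact : CompactSpace (stdSimplex ℝ (Fin (d + 1))) :=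
    isCompact_iff_compactSpace.1 (isCompact_stdSimplex ℝ _)
  have hgg (a b) : g a = g b ↔ f a = f b ∨ (P (f a) ∧ P (f b)) :=
    Quot.mk_eq_mk_iff_of_collapse (P := P) (fun _ _ => Iff.rfl) _ _
  have hPinl (i) (u : stdSimplex ℝ (Fin (d + 1))) :
      P (f (Sum.inl ⟨i, u⟩)) ↔ ∃ k, u.1 k = 0 := by
    rw [← simplexToSphere_eq_pt_iff]
    refine ⟨?_, fun h => Or.inr ⟨i, congrArg (fun p => (Sum.inl ⟨i, p⟩ : W)) h⟩⟩
    rintro (h | ⟨j, h⟩)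
    · cases h
    · exact eq_of_heq (Sigma.mk.inj (Sum.inl.inj h)).2
  have hsub (i j) (u : stdSimplex ℝ (Fin (d + 1))) (hu : ∀ b ∈ σ i, (φ j u).1 b ≠ 0) : i = j :=
    hinj (hmax i _ (hσK j) fun b hb => mem_of_faceMap_ne_zero (hu b hb)).symm
  have hDφ (i u) : D (φ i u) ↔ ∃ k, u.1 k = 0 := by
    rw [← exists_faceMap_eq_zero_iff (hσ := hσK i) (e := e i)]
    refine ⟨fun h => h _ ((hF _).2 ⟨i, rfl⟩), fun h τ hτ => ?_⟩
    obtain ⟨j, rfl⟩ := (hF τ).1 hτ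
    by_contra! hne
    obtain rfl := hsub j i u hne
    obtain ⟨b, hb, h0⟩ := h
    exact hne b hb h0
  have hD : ∀ z, D (π z) ↔ P (f z) := by
    rintro (⟨i, u⟩ | y)
    · rw [hPinl]; exact hDφ i u
    · exact iff_of_true ((mem_range_incl_iff hK F _).1 ⟨y, rfl⟩) (Or.inl rfl)
  have hfinj : ∀ a b, ¬ P (f a) → f a = f b → a = b := by
    rintro (⟨i, u⟩ | y) (⟨j, w⟩ | y') ha hab
    · obtain ⟨hij, h⟩ := Sigma.mk.inj (Sum.inl.inj hab)
      obtain rfl : i = j := hij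
      have hne : simplexToSphere u ≠ SphereD.pt d := by
        rwa [Ne, simplexToSphere_eq_pt_iff, ← hPinl i]
      rw [simplexToSphere_injOn hne (eq_of_heq h)]
    · simp [f] at hab
    all_goals exact absurd (Or.inl rfl) ha
  have hπinj : ∀ a b, ¬ P (f a) → π a = π b → a = b := by
    rintro (⟨i, u⟩ | y) (⟨j, w⟩ | y') ha hab
    · have hi : ∀ b ∈ σ i, (φ i u).1 b ≠ 0 := by
        rw [← hD] at ha
        by_contra! h
        exact ha ((hDφ i u).2 ((exists_faceMap_eq_zero_iff (hσ := hσK i) (e := e i) u).1 h))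
      have hab' : φ i u = φ j w := hab
      obtain rfl := hsub i j w (hab' ▸ hi)
      rw [faceMap_injective hab']
    · rw [← hD, hab, hD] at ha
      exact absurd (Or.inl rfl) ha
    all_goals exact absurd (Or.inl rfl) ha
  have hfac : Function.FactorsThrough g π := fun a b hab => by
    by_cases ha : P (f a)
    · exact (hgg a b).2 (Or.inr ⟨ha, by rwa [← hD, ← hab, hD]⟩)
    · rw [hπinj a b ha hab]
  have hπsurj : Function.Surjective π := fun x => by
    by_cases hx : D x
    · obtain ⟨y, rfl⟩ := (mem_range_incl_iff hK F x).2 hx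
      exact ⟨Sum.inr y, rfl⟩
    · simp only [D, not_forall] at hx
      obtain ⟨τ, hτ, hx⟩ := hx
      obtain ⟨i, rfl⟩ := (hF τ).1 hτ
      push Not at hx
      obtain ⟨u, rfl⟩ := mem_range_faceMap (hσ := hσK i) (e := e i) hK (hmax i) hx
      exact ⟨Sum.inl ⟨i, u⟩, rfl⟩
  have hφc : Continuous fun z : Σ _ : ι, stdSimplex ℝ (Fin (d + 1)) => φ z.1 z.2 :=
    continuous_sigma fun i => continuous_faceMap (hσ := hσK i) (e := e i)
  have hincl := isClosedEmbedding_incl_avoiding hK F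
  have hπ : IsQuotientMap π :=
    (hφc.isClosedMap.sumElim hincl.isClosedMap).isQuotientMap
      (hφc.sumElim hincl.continuous) hπsurj
  have hψc : Continuous (Sigma.map (id : ι → ι)
      fun _ => (simplexToSphere : stdSimplex ℝ (Fin (d + 1)) → SphereD d)) :=
    Continuous.sigma_map (σ := fun _ : ι => stdSimplex ℝ (Fin (d + 1)))
      (τ := fun _ : ι => SphereD d) fun _ => continuous_simplexToSphere
  have hf : IsQuotientMap f := by
    refine IsClosedMap.isQuotientMap (hψc.isClosedMap.sumMap fun s _ => isClosed_discrete _)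
      (hψc.sumMap continuous_const) ?_
    rintro (⟨i, p⟩ | y)
    · obtain ⟨u, rfl⟩ := simplexToSphere_surjective hd p
      exact ⟨Sum.inl ⟨i, u⟩, rfl⟩
    · exact ⟨Sum.inr (inferInstance : PathConnectedSpace _).nonempty.some, rfl⟩
  have hg : IsQuotientMap g := isQuotientMap_quot_mk.comp hf
  let q : C(Realization K, WedgeOfSpheres fun _ : ι => d) :=
    IsQuotientMap.lift (f := ⟨π, hπ.continuous⟩) hπ ⟨g, hg.continuous⟩ hfac
  have hq (z) : q (π z) = g z :=
    congrFun (congrArg DFunLike.coe (IsQuotientMap.lift_comp (f := ⟨π, hπ.continuous⟩) hπ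
      ⟨g, hg.continuous⟩ hfac)) z
  refine Realization.homotopyEquiv_of_collapse hK F q
    (.of_comp hπ.continuous q.continuous ?_) fun x y => ?_
  · rwa [show q ∘ π = g from funext hq]
  · obtain ⟨a, rfl⟩ := hπsurj x
    obtain ⟨b, rfl⟩ := hπsurj y
    change _ ↔ _ ∨ (D (π a) ∧ D (π b))
    rw [hq, hq, hgg, hD, hD]
    constructor
    · rintro (h | h)
      · by_cases ha : P (f a)
        · exact Or.inr ⟨ha, h ▸ ha⟩
        · exact Or.inl (congrArg π (hfinj a b ha h))
      · exact Or.inr h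
    · rintro (h | h)
      · exact (hgg a b).1 (hfac h)
      · exact Or.inr h

end Wedge

section Independence

variable {α : Type*} (r : α → α → Prop)

/-- The complex of finite subsets of `S` no two elements of which are related by `r`. -/
def independenceComplex (S : Set α) : Set (Finset α) :=
  {s | (∀ e ∈ s, e ∈ S) ∧ (s : Set α).Pairwise fun e f => ¬ r e f}

theorem isLowerSet_independenceComplex (S : Set α) : IsLowerSet (independenceComplex r S) :=
  fun _ _ h hs => ⟨fun e he => hs.1 e (h he), hs.2.mono (Finset.coe_subset.2 h)⟩

variable {r} {S : Set α} {F : Finset (Finset α)} {v : α}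

theorem finite_independenceComplex (hS : S.Finite) : (independenceComplex r S).Finite :=
  (hS.powerset.preimage Finset.coe_injective.injOn).subset fun _ => And.left

theorem avoiding_empty (K : Set (Finset α)) : avoiding K ∅ = K := by
  ext s
  simp [avoiding]

theorem insert_mem_independenceComplex [DecidableEq α] (hsymm : ∀ a b, r a b → r b a)
    {s : Finset α} (hs : s ∈ independenceComplex r S) (hv : v ∈ S)
    (h : ∀ w ∈ s, r v w → w = v) : insert v s ∈ independenceComplex r S := by
  refine ⟨fun e he => ?_, ?_⟩
  · obtain rfl | he := Finset.mem_insert.1 he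
    exacts [hv, hs.1 e he]
  · rw [Finset.coe_insert, Set.pairwise_insert]
    refine ⟨hs.2, fun w hw hne => ⟨fun h' => hne (h w hw h').symm,
      fun h' => hne (h w hw (hsymm _ _ h')).symm⟩⟩

theorem deletion_avoiding_independenceComplex :
    avoiding (avoiding (independenceComplex r S) F) {{v}} =
      avoiding (independenceComplex r (S \ {v})) F := by
  ext s
  simp only [avoiding, independenceComplex, Set.mem_ofPred_eq, Finset.mem_singleton, forall_eq,
    Finset.singleton_subset_iff, Set.mem_sdiff, Set.mem_singleton_iff]
  grind

theorem link_avoiding_independenceComplex [DecidableEq α] (hsymm : ∀ a b, r a b → r b a)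
    (hrefl : ∀ a, r a a) (hv : v ∈ S) :
    link (avoiding (independenceComplex r S) F) v =
      avoiding (independenceComplex r {w ∈ S | ¬ r v w}) (F.image fun σ => σ.erase v) := by
  ext s
  constructor
  · rintro ⟨hvs, ⟨hS, hp⟩, hF⟩
    rw [Finset.coe_insert, Set.pairwise_insert] at hp
    refine ⟨⟨fun e he => ⟨hS e (Finset.mem_insert_of_mem he), (hp.2 e he ?_).1⟩, hp.1⟩, ?_⟩
    · rintro rfl
      exact hvs he
    · simpa [← Finset.subset_insert_iff] using hF
  · rintro ⟨hs, hF⟩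
    refine ⟨fun h => (hs.1 v h).2 (hrefl v), insert_mem_independenceComplex hsymm
      ⟨fun e he => (hs.1 e he).1, hs.2⟩ hv fun w hw h => absurd h (hs.1 w hw).2, ?_⟩
    simpa [← Finset.subset_insert_iff] using hF

/-- If the element `v i` of an independence complex is removed, `p i` becomes isolated, so only the
links of the `v i` matter. -/
theorem contractibleSpace_of_isolating [DecidableEq α] (hsymm : ∀ a b, r a b → r b a)
    (hrefl : ∀ a, r a a) {ι : Type*} [DecidableEq ι] (v p : ι → α) (rank : ι → ℤ) (T : Finset ι) :
    ∀ (S : Set α) (F : Finset (Finset α)), S.Finite →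
    (∀ i ∈ T, v i ∈ S ∧ p i ∈ S ∧ p i ≠ v i) →
    (∀ i ∈ T, ∀ j ∈ T, i ≠ j → ¬ r (v i) (p j) ∧ ¬ r (v i) (v j)) →
    (∀ i ∈ T, ∀ w ∈ S, r (p i) w →
      w = p i ∨ w = v i ∨ ∃ j ∈ T, rank j < rank i ∧ r (v j) w) →
    (∀ σ ∈ F, T.image v ⊆ σ) →
    (avoiding (independenceComplex r {w ∈ S | ∀ i ∈ T, ¬ r (v i) w})
        (F.image fun σ => σ \ T.image v) = ∅ ∨
      ContractibleSpace (Realization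
        (avoiding (independenceComplex r {w ∈ S | ∀ i ∈ T, ¬ r (v i) w})
          (F.image fun σ => σ \ T.image v)))) →
    (avoiding (independenceComplex r S) F = ∅ ∨
      ContractibleSpace (Realization (avoiding (independenceComplex r S) F))) := by
  induction T using Finset.induction_on_min_value rank with
  | empty =>
    intro S F _ _ _ _ _ hbase
    have h₁ : {w ∈ S | ∀ i ∈ (∅ : Finset ι), ¬ r (v i) w} = S := by simp
    have h₂ : (F.image fun σ => σ \ (∅ : Finset ι).image v) = F := by simp
    rwa [h₁, h₂] at hbase
  | insert i T hi hmin ih =>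
    intro S F hS hmem hindep hnbr hF hbase
    obtain ⟨hvS, hpS, hpv⟩ := hmem i (Finset.mem_insert_self _ _)
    have hne : ∀ l ∈ T, l ≠ i := fun l hl h => hi (h ▸ hl)
    right
    refine contractibleSpace_of_link_of_deletion (v := v i)
      ((isLowerSet_independenceComplex r S).avoiding F)
      ((finite_independenceComplex hS).subset (avoiding_subset _ _)) ?_ ?_
    · rw [deletion_avoiding_independenceComplex]
      have hviF : ∀ σ ∈ F, v i ∈ σ := fun σ hσ =>
        hF σ hσ (Finset.mem_image_of_mem _ (Finset.mem_insert_self _ _))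
      refine contractibleSpace_of_cone (v := p i) ⟨∅, ⟨by simp, by simp⟩, fun σ hσ h => ?_⟩
        fun s hs => ⟨?_, fun σ hσ h => ?_⟩
      · simpa using h (hviF σ hσ)
      · refine insert_mem_independenceComplex hsymm hs.1 ⟨hpS, hpv⟩ fun w hw hpw => ?_
        obtain ⟨hwS, hwv⟩ := hs.1.1 w hw
        obtain h | h | ⟨j, hj, hlt, -⟩ := hnbr i (Finset.mem_insert_self _ _) w hwS hpw
        · exact h
        · exact absurd h hwv
        · obtain rfl | hj := Finset.mem_insert.1 hj
          · exact absurd hlt (lt_irrefl _)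
          · exact absurd hlt (hmin j hj).not_gt
      · obtain h | h := Finset.mem_insert.1 (h (hviF σ hσ))
        · exact hpv h.symm
        · exact (hs.1.1 _ h).2 rfl
    · rw [link_avoiding_independenceComplex hsymm hrefl hvS]
      refine ih _ _ (hS.subset fun w hw => hw.1) (fun l hl => ?_) (fun l hl k hk => ?_)
        (fun l hl w hw hlw => ?_) ?_ ?_
      · obtain ⟨h₁, h₂, h₃⟩ := hmem l (Finset.mem_insert_of_mem hl)
        have := hindep i (Finset.mem_insert_self _ _) l (Finset.mem_insert_of_mem hl)
          (hne l hl).symm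
        exact ⟨⟨h₁, this.2⟩, ⟨h₂, this.1⟩, h₃⟩
      · exact hindep l (Finset.mem_insert_of_mem hl) k (Finset.mem_insert_of_mem hk)
      · obtain h | h | ⟨j, hj, hlt, hr⟩ := hnbr l (Finset.mem_insert_of_mem hl) w hw.1 hlw
        · exact Or.inl h
        · exact Or.inr (Or.inl h)
        · obtain rfl | hj := Finset.mem_insert.1 hj
          · exact absurd hr hw.2
          · exact Or.inr (Or.inr ⟨j, hj, hlt, hr⟩)
      · simp only [Finset.forall_mem_image]
        intro σ hσ a ha
        refine Finset.mem_erase.2 ⟨?_, hF σ hσ ?_⟩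
        · rintro rfl
          obtain ⟨l, hl, hlv⟩ := Finset.mem_image.1 ha
          refine (hindep l (Finset.mem_insert_of_mem hl) i (Finset.mem_insert_self _ _)
            (hne l hl)).2 (hlv ▸ hrefl _)
        · rw [Finset.image_insert]
          exact Finset.mem_insert_of_mem ha
      · have h₁ : {w ∈ {w ∈ S | ¬ r (v i) w} | ∀ l ∈ T, ¬ r (v l) w} =
            {w ∈ S | ∀ l ∈ insert i T, ¬ r (v l) w} := by
          ext w
          simp [and_assoc]
        have h₂ : ((F.image fun σ => σ.erase (v i)).image fun σ => σ \ T.image v) =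
            F.image fun σ => σ \ (insert i T).image v := by
          rw [Finset.image_image]
          refine Finset.image_congr fun σ _ => ?_
          simp only [Function.comp_apply, Finset.image_insert, Finset.sdiff_insert]
          rw [Finset.erase_sdiff_comm]
        rwa [h₁, h₂]

end Independence

section Incidence

theorem EdgeIncident.symm {V : Type*} {e f : Sym2 V} (h : EdgeIncident e f) : EdgeIncident f e :=
  h.imp fun _ => And.symm

theorem EdgeIncident.refl {V : Type*} (e : Sym2 V) : EdgeIncident e e := by
  induction e with
  | _ a b => exact ⟨a, by simp, by simp⟩

theorem edgeIncident_mk_iff {V : Type*} {a b c d : V} :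
    EdgeIncident s(a, b) s(c, d) ↔ a = c ∨ a = d ∨ b = c ∨ b = d := by
  simp only [EdgeIncident, Sym2.mem_iff, or_and_right, and_or_left, exists_or, exists_eq_left,
    or_assoc]
  tauto

/-- The horizontal edge with left endpoint `z`. -/
def railEdge (z : ℤ × ℤ) : Sym2 (ℤ × ℤ) := s(z, (z.1 + 1, z.2))

/-- The vertical edge with abscissa `x`. -/
def rung (x : ℤ) : Sym2 (ℤ × ℤ) := s((x, 0), (x, 1))

theorem railEdge_injective : Function.Injective railEdge := fun z w h => by
  simp only [railEdge, Sym2.eq_iff, Prod.ext_iff] at h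
  ext <;> omega

theorem rung_injective : Function.Injective rung := fun x y h => by
  simp only [rung, Sym2.eq_iff, Prod.ext_iff] at h
  omega

theorem railEdge_ne_rung (z : ℤ × ℤ) (x : ℤ) : railEdge z ≠ rung x := fun h => by
  simp only [railEdge, rung, Sym2.eq_iff, Prod.ext_iff] at h
  omega

theorem edgeIncident_railEdge_railEdge {z w : ℤ × ℤ} : EdgeIncident (railEdge z) (railEdge w) ↔
    z.2 = w.2 ∧ (z.1 = w.1 ∨ z.1 = w.1 + 1 ∨ w.1 = z.1 + 1) := by
  simp only [railEdge, edgeIncident_mk_iff, Prod.ext_iff]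
  omega

theorem edgeIncident_railEdge_rung {z : ℤ × ℤ} {x : ℤ} : EdgeIncident (railEdge z) (rung x) ↔
    (z.2 = 0 ∨ z.2 = 1) ∧ (z.1 = x ∨ z.1 + 1 = x) := by
  simp only [railEdge, rung, edgeIncident_mk_iff, Prod.ext_iff]
  omega

theorem edgeIncident_rung_railEdge {z : ℤ × ℤ} {x : ℤ} : EdgeIncident (rung x) (railEdge z) ↔
    (z.2 = 0 ∨ z.2 = 1) ∧ (z.1 = x ∨ z.1 + 1 = x) :=
  ⟨fun h => edgeIncident_railEdge_rung.1 h.symm, fun h => (edgeIncident_railEdge_rung.2 h).symm⟩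

end Incidence

section PolygonChain

/-- The edges of the chain of `t` polygons with `2 * (3 * m + 1)` sides each, without its
rungs `1, …, j`. -/
def polygonChainEdges (m t j : ℕ) : Set (Sym2 (ℤ × ℤ)) :=
  {e | (∃ z : ℤ × ℤ, (z.2 = 0 ∨ z.2 = 1) ∧ 0 ≤ z.1 ∧ z.1 < 3 * ((m : ℤ) * t) ∧ e = railEdge z) ∨
    ∃ k : ℕ, k ≤ t ∧ (k = 0 ∨ j < k) ∧ e = rung (3 * ((m : ℤ) * k))}

variable {m t j : ℕ}

theorem railEdge_mem_polygonChainEdges {z : ℤ × ℤ} : railEdge z ∈ polygonChainEdges m t j ↔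
    (z.2 = 0 ∨ z.2 = 1) ∧ 0 ≤ z.1 ∧ z.1 < 3 * ((m : ℤ) * t) := by
  constructor
  · rintro (⟨w, h₁, h₂, h₃, h⟩ | ⟨k, -, -, h⟩)
    · obtain rfl := railEdge_injective h
      exact ⟨h₁, h₂, h₃⟩
    · exact absurd h (railEdge_ne_rung _ _)
  · rintro ⟨h₁, h₂, h₃⟩
    exact Or.inl ⟨z, h₁, h₂, h₃, rfl⟩

theorem rung_mem_polygonChainEdges (hm : m ≠ 0) {k : ℕ} :
    rung (3 * ((m : ℤ) * k)) ∈ polygonChainEdges m t j ↔ k ≤ t ∧ (k = 0 ∨ j < k) := by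
  constructor
  · rintro (⟨w, -, -, -, h⟩ | ⟨l, h₁, h₂, h⟩)
    · exact absurd h.symm (railEdge_ne_rung _ _)
    · have := rung_injective h
      obtain rfl : k = l := by simpa [hm] using this
      exact ⟨h₁, h₂⟩
  · rintro ⟨h₁, h₂⟩
    exact Or.inr ⟨k, h₁, h₂, rfl⟩

theorem polygonChainEdges_diff_rung (hm : m ≠ 0) :
    polygonChainEdges m t j \ {rung (3 * ((m : ℤ) * (j + 1 : ℕ)))} =
      polygonChainEdges m t (j + 1) := by
  ext e
  constructor
  · rintro ⟨⟨z, h₁, h₂, h₃, rfl⟩ | ⟨k, h₁, h₂, rfl⟩, h⟩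
    · exact Or.inl ⟨z, h₁, h₂, h₃, rfl⟩
    · refine Or.inr ⟨k, h₁, ?_, rfl⟩
      have : k ≠ j + 1 := by rintro rfl; exact h rfl
      omega
  · rintro (⟨z, h₁, h₂, h₃, rfl⟩ | ⟨k, h₁, h₂, rfl⟩)
    · exact ⟨Or.inl ⟨z, h₁, h₂, h₃, rfl⟩, railEdge_ne_rung _ _⟩
    · refine ⟨Or.inr ⟨k, h₁, by omega, rfl⟩, fun h => ?_⟩
      have : (k : ℤ) = j + 1 := by simpa [hm] using rung_injective h
      omega

theorem finite_polygonChainEdges : (polygonChainEdges m t j).Finite := by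
  refine (((Finset.Ico (0 : ℤ) (3 * ((m : ℤ) * t)) ×ˢ {0, 1}).finite_toSet.image railEdge).union
    ((Finset.range (t + 1)).finite_toSet.image fun k : ℕ => rung (3 * ((m : ℤ) * k)))).subset ?_
  rintro _ (⟨z, h₁, h₂, h₃, rfl⟩ | ⟨k, h₁, -, rfl⟩)
  · exact Or.inl ⟨z, by simp [h₁, h₂, h₃], rfl⟩
  · exact Or.inr ⟨k, by simp; omega, rfl⟩

theorem exists_eq_of_dvd (hm : m ≠ 0) {x : ℤ} (hx : 3 * (m : ℤ) ∣ x) (h₀ : 0 ≤ x)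
    (h₁ : x ≤ 3 * ((m : ℤ) * t)) : ∃ k : ℕ, k ≤ t ∧ x = 3 * ((m : ℤ) * k) := by
  obtain ⟨c, rfl⟩ := hx
  have hm' : 0 < 3 * (m : ℤ) := by positivity
  lift c to ℕ using nonneg_of_mul_nonneg_right h₀ hm'
  rw [← mul_assoc] at h₁
  exact ⟨c, by exact_mod_cast le_of_mul_le_mul_left h₁ hm', mul_assoc _ _ _⟩

theorem edgeSet_polygonChain (hm : m ≠ 0) :
    (polygonChain (3 * m + 1) t).edgeSet = polygonChainEdges m t 0 := by
  have hm' : ((3 * m + 1 : ℕ) : ℤ) - 1 = 3 * (m : ℤ) := by push_cast; ring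
  have hN : (t : ℤ) * (((3 * m + 1 : ℕ) : ℤ) - 1) = 3 * ((m : ℤ) * t) := by push_cast; ring
  ext e
  induction e with
  | _ p q =>
  rw [SimpleGraph.mem_edgeSet, polygonChain, SimpleGraph.fromRel_adj, hN, hm']
  constructor
  · have hrung : ∀ p q : ℤ × ℤ, p.2 = 0 → q.2 = 1 → q.1 = p.1 → 3 * (m : ℤ) ∣ p.1 → 0 ≤ p.1 →
        p.1 ≤ 3 * ((m : ℤ) * t) → s(p, q) ∈ polygonChainEdges m t 0 := by
      intro p q h₁ h₂ h₃ h₄ h₅ h₆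
      obtain ⟨k, hk, h⟩ := exists_eq_of_dvd hm h₄ h₅ h₆
      refine Or.inr ⟨k, hk, Nat.eq_zero_or_pos k, ?_⟩
      rw [rung, ← h]
      exact Sym2.eq_iff.2 (Or.inl ⟨Prod.ext rfl h₁, Prod.ext h₃ h₂⟩)
    rintro ⟨-, (⟨h₁, h₂, h₃, h₄, h₅⟩ | ⟨h₁, h₂, h₃, h₄, h₅, h₆⟩) |
      (⟨h₁, h₂, h₃, h₄, h₅⟩ | ⟨h₁, h₂, h₃, h₄, h₅, h₆⟩)⟩
    · exact Or.inl ⟨p, h₁, h₄, h₅, by rw [railEdge, ← h₃, ← h₂]⟩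
    · exact hrung p q h₁ h₂ h₃ h₄ h₅ h₆
    · exact Or.inl ⟨q, h₁, h₄, h₅, by rw [railEdge, ← h₃, ← h₂, Sym2.eq_swap]⟩
    · exact Sym2.eq_swap ▸ hrung q p h₁ h₂ h₃ h₄ h₅ h₆
  · rintro (⟨z, h₁, h₂, h₃, h⟩ | ⟨k, hk, -, h⟩)
    · rw [railEdge, Sym2.eq_iff] at h
      obtain ⟨rfl, rfl⟩ | ⟨rfl, rfl⟩ := h
      · exact ⟨by simp [Prod.ext_iff], Or.inl (Or.inl ⟨h₁, rfl, rfl, h₂, h₃⟩)⟩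
      · exact ⟨by simp [Prod.ext_iff], Or.inr (Or.inl ⟨h₁, rfl, rfl, h₂, h₃⟩)⟩
    · have hdvd : 3 * (m : ℤ) ∣ 3 * ((m : ℤ) * k) := ⟨k, by ring⟩
      have h₀ : 0 ≤ 3 * ((m : ℤ) * k) := by positivity
      have h₁ : 3 * ((m : ℤ) * k) ≤ 3 * ((m : ℤ) * t) := by gcongr
      rw [rung, Sym2.eq_iff] at h
      obtain ⟨rfl, rfl⟩ | ⟨rfl, rfl⟩ := h
      · exact ⟨by simp, Or.inl (Or.inr ⟨rfl, rfl, rfl, hdvd, h₀, h₁⟩)⟩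
      · exact ⟨by simp, Or.inr (Or.inr ⟨rfl, rfl, rfl, hdvd, h₀, h₁⟩)⟩

/-- The index set of the triples of consecutive horizontal edges. -/
noncomputable def triples (M : ℤ) : Finset (ℤ × ℤ) := Finset.Ico 0 M ×ˢ {0, 1}

theorem mem_triples {M : ℤ} {z : ℤ × ℤ} :
    z ∈ triples M ↔ (0 ≤ z.1 ∧ z.1 < M) ∧ (z.2 = 0 ∨ z.2 = 1) := by
  simp [triples]

/-- The edge of a triple on the side that is away from the abscissa `3 * a`. -/
def outerEdge (a : ℤ) (z : ℤ × ℤ) : Sym2 (ℤ × ℤ) :=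
  railEdge (if z.1 < a then 3 * z.1 else 3 * z.1 + 2, z.2)

/-- The middle edge of a triple. -/
def middleEdge (z : ℤ × ℤ) : Sym2 (ℤ × ℤ) := railEdge (3 * z.1 + 1, z.2)

theorem outerEdge_injective (a : ℤ) : Function.Injective (outerEdge a) := fun z w h => by
  have := railEdge_injective h
  simp only [Prod.mk.injEq] at this
  ext <;> grind

/-- The facet that consists of one rung and of the outer edges of the triples. -/
noncomputable def chainFacet (M a : ℤ) : Finset (Sym2 (ℤ × ℤ)) :=
  insert (rung (3 * a)) ((triples M).image (outerEdge a))

theorem rung_notMem_image_outerEdge (a b : ℤ) (T : Finset (ℤ × ℤ)) :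
    rung b ∉ T.image (outerEdge a) := fun h => by
  obtain ⟨z, -, hz⟩ := Finset.mem_image.1 h
  exact railEdge_ne_rung _ _ hz

theorem rung_mem_chainFacet {M a b : ℤ} : rung (3 * b) ∈ chainFacet M a ↔ b = a := by
  rw [chainFacet, Finset.mem_insert, or_iff_left (rung_notMem_image_outerEdge _ _ _),
    rung_injective.eq_iff]
  omega

theorem card_chainFacet (M : ℕ) (a : ℤ) : (chainFacet M a).card = 2 * M + 1 := by
  rw [chainFacet, Finset.card_insert_of_notMem (rung_notMem_image_outerEdge _ _ _),
    Finset.card_image_of_injective _ (outerEdge_injective a), triples, Finset.card_product]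
  simp [mul_comm]

theorem not_edgeIncident_outerEdge {a : ℤ} {z w : ℤ × ℤ} (h : z ≠ w) :
    ¬ EdgeIncident (outerEdge a z) (outerEdge a w) := by
  rw [outerEdge, outerEdge, edgeIncident_railEdge_railEdge]
  rw [Ne, Prod.ext_iff] at h
  dsimp only
  split_ifs <;> omega

theorem not_edgeIncident_outerEdge_middleEdge {a : ℤ} {z w : ℤ × ℤ} (h : z ≠ w) :
    ¬ EdgeIncident (outerEdge a z) (middleEdge w) := by
  rw [outerEdge, middleEdge, edgeIncident_railEdge_railEdge]
  rw [Ne, Prod.ext_iff] at h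
  dsimp only
  split_ifs <;> omega

theorem not_edgeIncident_rung_outerEdge (a : ℤ) (z : ℤ × ℤ) :
    ¬ EdgeIncident (rung (3 * a)) (outerEdge a z) := by
  rw [outerEdge, edgeIncident_rung_railEdge]
  dsimp only
  split_ifs <;> omega

theorem not_edgeIncident_rung_middleEdge (a : ℤ) (z : ℤ × ℤ) :
    ¬ EdgeIncident (rung (3 * a)) (middleEdge z) := by
  rw [middleEdge, edgeIncident_rung_railEdge]
  omega

end PolygonChain

section Facets

variable {m t j : ℕ}

theorem mul_add_one_le (hm : m ≠ 0) {k l : ℕ} (h : k < l) :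
    (m : ℤ) * k + 1 ≤ (m : ℤ) * l := by
  have : m * k < m * l := Nat.mul_lt_mul_of_pos_left h (Nat.pos_of_ne_zero hm)
  exact_mod_cast this

theorem outerEdge_mem_polygonChainEdges {a : ℤ} {z : ℤ × ℤ} (hz : z ∈ triples ((m : ℤ) * t)) :
    outerEdge a z ∈ polygonChainEdges m t j := by
  rw [mem_triples] at hz
  rw [outerEdge, railEdge_mem_polygonChainEdges]
  dsimp only
  split_ifs <;> omega

theorem middleEdge_mem_polygonChainEdges {z : ℤ × ℤ} (hz : z ∈ triples ((m : ℤ) * t)) :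
    middleEdge z ∈ polygonChainEdges m t j := by
  rw [mem_triples] at hz
  rw [middleEdge, railEdge_mem_polygonChainEdges]
  omega

theorem chainFacet_mem (hm : m ≠ 0) {k : ℕ} (hk : k ≤ t) :
    chainFacet ((m : ℤ) * t) ((m : ℤ) * k) ∈
      independenceComplex EdgeIncident (polygonChainEdges m t 0) := by
  refine insert_mem_independenceComplex (fun _ _ => EdgeIncident.symm) ⟨?_, ?_⟩
    ((rung_mem_polygonChainEdges hm).2 ⟨hk, Nat.eq_zero_or_pos k⟩) ?_
  · simp only [Finset.forall_mem_image]
    exact fun z hz => outerEdge_mem_polygonChainEdges hz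
  · intro e he f hf hef
    obtain ⟨z, -, rfl⟩ := Finset.mem_image.1 he
    obtain ⟨w, -, rfl⟩ := Finset.mem_image.1 hf
    exact not_edgeIncident_outerEdge (ne_of_apply_ne _ hef)
  · simp only [Finset.forall_mem_image]
    exact fun z _ h => absurd h (not_edgeIncident_rung_outerEdge _ _)

theorem exists_outerEdge_incident_rung (hm : m ≠ 0) {k l : ℕ} (hk : k ≤ t) (hl : l ≤ t)
    (hkl : k ≠ l) : ∃ z ∈ triples ((m : ℤ) * t),
      EdgeIncident (outerEdge ((m : ℤ) * k) z) (rung (3 * ((m : ℤ) * l))) := by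
  simp only [mem_triples, outerEdge, edgeIncident_railEdge_rung]
  have h₀ : 0 ≤ (m : ℤ) * l := by positivity
  have h₁ : 0 ≤ (m : ℤ) * k := by positivity
  have h₂ : (m : ℤ) * l ≤ m * t := by gcongr
  have h₃ : (m : ℤ) * k ≤ m * t := by gcongr
  obtain h | h := hkl.lt_or_gt
  · have := mul_add_one_le hm h
    refine ⟨((m : ℤ) * l - 1, 0), by omega, by omega, ?_⟩
    dsimp only
    split_ifs <;> omega
  · have := mul_add_one_le hm h
    refine ⟨((m : ℤ) * l, 0), by omega, by omega, ?_⟩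
    dsimp only
    split_ifs <;> omega

theorem exists_mem_chainFacet_incident (hm : m ≠ 0) {k : ℕ} (hk : k ≤ t) {e : Sym2 (ℤ × ℤ)}
    (he : e ∈ polygonChainEdges m t 0) :
    ∃ f ∈ chainFacet ((m : ℤ) * t) ((m : ℤ) * k), EdgeIncident f e := by
  have hrung : rung (3 * ((m : ℤ) * k)) ∈ chainFacet ((m : ℤ) * t) ((m : ℤ) * k) :=
    Finset.mem_insert_self _ _
  have houter : ∀ z ∈ triples ((m : ℤ) * t),
      outerEdge ((m : ℤ) * k) z ∈ chainFacet ((m : ℤ) * t) ((m : ℤ) * k) := fun z hz =>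
    Finset.mem_insert_of_mem (Finset.mem_image_of_mem _ hz)
  have h₁ : 0 ≤ (m : ℤ) * k := by positivity
  have h₃ : (m : ℤ) * k ≤ m * t := by gcongr
  obtain ⟨z, hz, hz₀, hzN, rfl⟩ | ⟨l, hl, -, rfl⟩ := he
  · by_cases hr : z.1 = 3 * ((m : ℤ) * k) ∨ z.1 + 1 = 3 * ((m : ℤ) * k)
    · exact ⟨_, hrung, edgeIncident_rung_railEdge.2 ⟨hz, hr⟩⟩
    · have key : ∃ q, (0 ≤ q ∧ q < (m : ℤ) * t) ∧
          EdgeIncident (outerEdge ((m : ℤ) * k) (q, z.2)) (railEdge z) := by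
        simp only [outerEdge, edgeIncident_railEdge_railEdge, true_and]
        by_cases hlt : z.1 < 3 * ((m : ℤ) * k)
        · refine ⟨(z.1 + 1) / 3, by omega, ?_⟩
          rw [if_pos (by omega)]
          omega
        · refine ⟨(z.1 - 1) / 3, by omega, ?_⟩
          rw [if_neg (by omega)]
          omega
      obtain ⟨q, hq, h⟩ := key
      exact ⟨_, houter (q, z.2) (mem_triples.2 ⟨hq, hz⟩), h⟩
  · by_cases hkl : k = l
    · subst hkl
      exact ⟨_, hrung, .refl _⟩
    · obtain ⟨z, hz, h⟩ := exists_outerEdge_incident_rung hm hk hl hkl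
      exact ⟨_, houter z hz, h⟩

theorem eq_chainFacet_of_subset (hm : m ≠ 0) {k : ℕ} (hk : k ≤ t) {s : Finset (Sym2 (ℤ × ℤ))}
    (hs : s ∈ independenceComplex EdgeIncident (polygonChainEdges m t 0))
    (h : chainFacet ((m : ℤ) * t) ((m : ℤ) * k) ⊆ s) :
    s = chainFacet ((m : ℤ) * t) ((m : ℤ) * k) := by
  refine Finset.Subset.antisymm (fun e he => ?_) h
  obtain ⟨f, hf, hfe⟩ := exists_mem_chainFacet_incident hm hk (hs.1 e he)
  obtain rfl : f = e := by_contra fun hne => hs.2 (h hf) he hne hfe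
  exact hf

theorem chainFacet_injective (hm : m ≠ 0) :
    Function.Injective fun k : ℕ => chainFacet ((m : ℤ) * t) ((m : ℤ) * k) := fun k l h => by
  have : rung (3 * ((m : ℤ) * k)) ∈ chainFacet ((m : ℤ) * t) ((m : ℤ) * l) := by
    dsimp only at h
    rw [← h, rung_mem_chainFacet]
  simpa [hm] using rung_mem_chainFacet.1 this

end Facets

section Contractible

theorem avoiding_insert_of_forall_not_subset {α : Type*} [DecidableEq α] {K : Set (Finset α)}
    {F : Finset (Finset α)} {σ : Finset α} (h : ∀ s ∈ K, ¬ σ ⊆ s) :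
    avoiding K (insert σ F) = avoiding K F := by
  ext s
  simp only [avoiding, Finset.forall_mem_insert, Set.mem_ofPred_eq]
  exact ⟨fun hs => ⟨hs.1, hs.2.2⟩, fun hs => ⟨hs.1, h s hs.1, hs.2⟩⟩

theorem avoiding_insert_image_of_forall_not_subset {α ι : Type*} [DecidableEq α]
    {K : Set (Finset α)} {T : Finset ι} {f : ι → Finset α} {σ : Finset α}
    (h : ∀ i ∈ T, ∀ s ∈ K, ¬ f i ⊆ s) : avoiding K (insert σ (T.image f)) = avoiding K {σ} := by
  ext s
  simp only [avoiding, Finset.forall_mem_insert, Finset.forall_mem_image, Finset.mem_singleton,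
    forall_eq, Set.mem_ofPred_eq]
  exact ⟨fun hs => ⟨hs.1, hs.2.1⟩, fun hs => ⟨hs.1, hs.2, fun i hi => h i hi s hs.1⟩⟩

variable {m t j : ℕ}

theorem contractibleSpace_polygonChainEdges_self :
    ContractibleSpace (Realization
      (independenceComplex EdgeIncident (polygonChainEdges m t t))) := by
  have h := contractibleSpace_of_isolating (r := EdgeIncident) (fun _ _ => EdgeIncident.symm)
    EdgeIncident.refl middleEdge (outerEdge 0) (fun z => -z.1) (triples ((m : ℤ) * t))
    (polygonChainEdges m t t) ∅ finite_polygonChainEdges ?_ ?_ ?_ (by simp) ?_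
  · rw [avoiding_empty] at h
    refine h.resolve_left fun h => ?_
    exact h.le (show ∅ ∈ _ from ⟨by simp, by simp⟩)
  · refine fun z hz => ⟨middleEdge_mem_polygonChainEdges hz, outerEdge_mem_polygonChainEdges hz,
      fun h => ?_⟩
    have := congrArg Prod.fst (railEdge_injective h)
    dsimp only at this
    split_ifs at this <;> omega
  · refine fun z hz w hw hzw =>
      ⟨fun h => not_edgeIncident_outerEdge_middleEdge hzw.symm h.symm, fun h => ?_⟩
    rw [middleEdge, middleEdge, edgeIncident_railEdge_railEdge] at h
    rw [Ne, Prod.ext_iff] at hzw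
    omega
  · intro z hz w hw h
    have hz' := mem_triples.1 hz
    rw [outerEdge, if_neg (by omega)] at h ⊢
    obtain ⟨w, -, -, hwN, rfl⟩ | ⟨l, hlt, hl, rfl⟩ := hw
    · rw [edgeIncident_railEdge_railEdge] at h
      obtain ⟨h₂, h₁ | h₁ | h₁⟩ := h
      · exact Or.inl (congrArg railEdge (Prod.ext h₁.symm h₂.symm))
      · exact Or.inr (Or.inl (congrArg railEdge (Prod.ext (by dsimp only at h₁ ⊢; omega) h₂.symm)))
      · refine Or.inr (Or.inr ⟨(z.1 + 1, z.2), mem_triples.2 ?_, by simp, ?_⟩)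
        · dsimp only at h₁ ⊢
          omega
        · rw [middleEdge, edgeIncident_railEdge_railEdge]
          dsimp only at h₁ h₂ ⊢
          omega
    · rw [edgeIncident_railEdge_rung] at h
      obtain rfl : l = 0 := by omega
      dsimp only at h
      omega
  · right
    rw [Finset.image_empty, avoiding_empty]
    have h₀ : rung 0 ∈ polygonChainEdges m t t := Or.inr ⟨0, Nat.zero_le t, Or.inl rfl, by simp⟩
    refine contractibleSpace_of_cone (v := rung 0) ⟨∅, by simp, by simp⟩ fun s hs =>
      insert_mem_independenceComplex (fun _ _ => EdgeIncident.symm) hs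
        ⟨h₀, fun z _ => ?_⟩ fun w hw _ => ?_
    · exact fun h => not_edgeIncident_rung_middleEdge 0 z h.symm
    · obtain ⟨⟨w, hw₂, h₀, hN, rfl⟩ | ⟨l, hl, hl', rfl⟩, h⟩ := hs.1 w hw
      · refine absurd ?_ (h (w.1 / 3, w.2) (mem_triples.2 ⟨by dsimp only; omega, hw₂⟩))
        rw [middleEdge, edgeIncident_railEdge_railEdge]
        dsimp only
        omega
      · obtain rfl : l = 0 := by omega
        simp

theorem contractibleSpace_link_rung (hm : m ≠ 0) {k : ℕ} (hk : k ≤ t) :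
    avoiding (independenceComplex EdgeIncident
        {e ∈ polygonChainEdges m t j | ¬ EdgeIncident (rung (3 * ((m : ℤ) * k))) e})
        {(triples ((m : ℤ) * t)).image (outerEdge ((m : ℤ) * k))} = ∅ ∨
      ContractibleSpace (Realization (avoiding (independenceComplex EdgeIncident
        {e ∈ polygonChainEdges m t j | ¬ EdgeIncident (rung (3 * ((m : ℤ) * k))) e})
        {(triples ((m : ℤ) * t)).image (outerEdge ((m : ℤ) * k))})) := by
  refine contractibleSpace_of_isolating (r := EdgeIncident) (fun _ _ => EdgeIncident.symm)
    EdgeIncident.refl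
    (outerEdge ((m : ℤ) * k)) middleEdge
    (fun z => if z.1 < (m : ℤ) * k then (m : ℤ) * k - z.1 else z.1 - (m : ℤ) * k)
    (triples ((m : ℤ) * t)) _ _ (finite_polygonChainEdges.subset fun _ => And.left) ?_ ?_ ?_ ?_ ?_
  · refine fun z hz => ⟨⟨outerEdge_mem_polygonChainEdges hz, not_edgeIncident_rung_outerEdge _ _⟩,
      ⟨middleEdge_mem_polygonChainEdges hz, not_edgeIncident_rung_middleEdge _ _⟩, fun h => ?_⟩
    have := congrArg Prod.fst (railEdge_injective h)
    dsimp only at this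
    split_ifs at this <;> omega
  · exact fun z _ w _ hzw =>
      ⟨not_edgeIncident_outerEdge_middleEdge hzw, not_edgeIncident_outerEdge hzw⟩
  · rintro z hz w ⟨hw, hkw⟩ h
    have hz' := mem_triples.1 hz
    have h₁ : 0 ≤ (m : ℤ) * k := by positivity
    have h₃ : (m : ℤ) * k ≤ m * t := by gcongr
    obtain ⟨w, hw, hw₀, hwN, rfl⟩ | ⟨l, -, -, rfl⟩ := hw
    · rw [edgeIncident_rung_railEdge] at hkw
      rw [middleEdge, edgeIncident_railEdge_railEdge] at h
      obtain ⟨h₂, h⟩ := h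
      dsimp only at h₂ h
      by_cases hwz : w.1 = 3 * z.1 + 1
      · exact Or.inl (congrArg railEdge (Prod.ext hwz h₂.symm))
      · right
        by_cases hlt : z.1 < (m : ℤ) * k
        · obtain h | h : w.1 = 3 * z.1 ∨ w.1 = 3 * z.1 + 2 := by omega
          · left
            rw [outerEdge, if_pos hlt]
            exact congrArg railEdge (Prod.ext h h₂.symm)
          · refine Or.inr ⟨(z.1 + 1, z.2), mem_triples.2 (by dsimp only; omega), ?_, ?_⟩
            · rw [if_pos hlt, if_pos (by dsimp only; omega)]
              dsimp only
              omega
            · rw [outerEdge, edgeIncident_railEdge_railEdge, if_pos (by dsimp only; omega)]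
              dsimp only
              omega
        · obtain h | h : w.1 = 3 * z.1 + 2 ∨ w.1 = 3 * z.1 := by omega
          · left
            rw [outerEdge, if_neg hlt]
            exact congrArg railEdge (Prod.ext h h₂.symm)
          · refine Or.inr ⟨(z.1 - 1, z.2), mem_triples.2 (by dsimp only; omega), ?_, ?_⟩
            · rw [if_neg hlt, if_neg (by dsimp only; omega)]
              dsimp only
              omega
            · rw [outerEdge, edgeIncident_railEdge_railEdge, if_neg (by dsimp only; omega)]
              dsimp only
              omega
    · exact absurd h.symm (not_edgeIncident_rung_middleEdge _ _)
  · simp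
  · left
    refine Set.eq_empty_of_forall_notMem fun s hs => hs.2 ∅ ?_ (Finset.empty_subset s)
    simp

theorem contractibleSpace_avoiding_chainFacet (hm : m ≠ 0) (hj : j ≤ t) :
    ContractibleSpace (Realization (avoiding
      (independenceComplex EdgeIncident (polygonChainEdges m t j))
      ((Finset.Ioc j t).image fun k : ℕ => chainFacet ((m : ℤ) * t) ((m : ℤ) * k)))) := by
  induction hj using Nat.decreasingInduction with
  | self =>
    rw [Finset.Ioc_self, Finset.image_empty, avoiding_empty]
    exact contractibleSpace_polygonChainEdges_self
  | of_succ j hj ih =>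
    have hmem : rung (3 * ((m : ℤ) * (j + 1 : ℕ))) ∈ polygonChainEdges m t j :=
      (rung_mem_polygonChainEdges hm).2 ⟨hj, by omega⟩
    have hIoc : Finset.Ioc j t = insert (j + 1) (Finset.Ioc (j + 1) t) := by
      ext k
      simp only [Finset.mem_Ioc, Finset.mem_insert]
      omega
    rw [hIoc, Finset.image_insert]
    refine contractibleSpace_of_link_of_deletion (v := rung (3 * ((m : ℤ) * (j + 1 : ℕ))))
      ((isLowerSet_independenceComplex _ _).avoiding _)
      ((finite_independenceComplex finite_polygonChainEdges).subset (avoiding_subset _ _)) ?_ ?_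
    · rw [deletion_avoiding_independenceComplex, polygonChainEdges_diff_rung hm,
        avoiding_insert_of_forall_not_subset]
      · exact ih
      · intro s hs h
        have := hs.1 _ (h (Finset.mem_insert_self _ _))
        rw [rung_mem_polygonChainEdges hm] at this
        omega
    · rw [link_avoiding_independenceComplex (r := EdgeIncident) (fun _ _ => EdgeIncident.symm)
        EdgeIncident.refl hmem]
      have hF : ∀ l ∈ Finset.Ioc (j + 1) t,
          ∀ s ∈ independenceComplex EdgeIncident {e ∈ polygonChainEdges m t j |
            ¬ EdgeIncident (rung (3 * ((m : ℤ) * (j + 1 : ℕ)))) e},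
          ¬ (chainFacet ((m : ℤ) * t) ((m : ℤ) * l)).erase
            (rung (3 * ((m : ℤ) * (j + 1 : ℕ)))) ⊆ s := by
        intro l hl s hs h
        rw [Finset.mem_Ioc] at hl
        obtain ⟨z, hz, hzl⟩ := exists_outerEdge_incident_rung hm hl.2 hj (by omega)
        exact (hs.1 _ (h (Finset.mem_erase.2 ⟨railEdge_ne_rung _ _, Finset.mem_insert_of_mem
          (Finset.mem_image_of_mem _ hz)⟩))).2 hzl.symm
      have := contractibleSpace_link_rung (j := j) hm hj
      rw [Finset.image_insert, chainFacet,
        Finset.erase_insert (rung_notMem_image_outerEdge _ _ _), Finset.image_image]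
      rwa [avoiding_insert_image_of_forall_not_subset
        (f := (fun σ => σ.erase (rung (3 * ((m : ℤ) * (j + 1 : ℕ))))) ∘ fun k : ℕ =>
          chainFacet ((m : ℤ) * t) ((m : ℤ) * k)) hF]

end Contractible

/-- For `n > 2` with `n ≡ 1 (mod 3)` and `t ≥ 2`, the matching complex
of the graph of `t` `2n`-gons in a line is homotopy equivalent to a wedge of exactly `t`
spheres, each of dimension `(2nt + t)/3 − t`. -/
theorem matchingComplex_polygonChain_wedge (t n : ℕ) (ht : 2 ≤ t) (hn : 2 < n)
    (hn1 : n % 3 = 1) :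
    Nonempty
      (ContinuousMap.HomotopyEquiv
        (Realization (matchingComplex (polygonChain n t)))
        (WedgeOfSpheres (fun _ : Fin t => (2 * n * t + t) / 3 - t))) := by
  obtain ⟨m, rfl⟩ : ∃ m, n = 3 * m + 1 := ⟨n / 3, by omega⟩
  have hm : m ≠ 0 := by omega
  have hd : (2 * (3 * m + 1) * t + t) / 3 - t = 2 * (m * t) := by
    rw [show 2 * (3 * m + 1) * t + t = 3 * (2 * (m * t) + t) by ring,
      Nat.mul_div_cancel_left _ three_pos, Nat.add_sub_cancel]
  have hK : matchingComplex (polygonChain (3 * m + 1) t) =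
      independenceComplex EdgeIncident (polygonChainEdges m t 0) := by
    rw [← edgeSet_polygonChain hm]
    rfl
  rw [hd, hK]
  have := contractibleSpace_avoiding_chainFacet hm (Nat.zero_le t)
  refine homotopyEquiv_wedgeOfSpheres
    (F := (Finset.Ioc 0 t).image fun k : ℕ => chainFacet ((m : ℤ) * t) ((m : ℤ) * k))
    (σ := fun i : Fin t => chainFacet ((m : ℤ) * t) ((m : ℤ) * (i + 1 : ℕ)))
    (by positivity) (isLowerSet_independenceComplex _ _) (fun s => ?_)
    (fun i => chainFacet_mem hm i.2)
    (fun i => by exact_mod_cast card_chainFacet (m * t) _)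
    (fun i s hs => eq_chainFacet_of_subset hm i.2 hs)
    fun i k h => Fin.ext (Nat.succ_injective (chainFacet_injective hm h))
  rw [Finset.mem_image]
  constructor
  · rintro ⟨k, hk, rfl⟩
    rw [Finset.mem_Ioc] at hk
    exact ⟨⟨k - 1, by omega⟩, by simp only [Nat.sub_add_cancel hk.1]⟩
  · rintro ⟨i, rfl⟩
    exact ⟨i + 1, Finset.mem_Ioc.2 ⟨by omega, i.2⟩, rfl⟩
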